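/- Let α∈(0,1) and θ∈ℝ with α+θ>0, and let (K_n,(K_{r,n})_{r≥1}) be the Ewens–Pitman block-counting chain with parameters (α,θ). There exists a random variable S_{α,θ} with 0<S_{α,θ}<∞ almost surely such that K_n/n^α→S_{α,θ} almost surely, and for every integer r≥1 the predictable quadratic variation ⟨M_r⟩_n = ∑_{k=1}^{n−1} E[(M_{r,k+1}−M_{r,k})² | F_k] of the martingale (M_{r,n}) satisfies, almost surely, lim_{n→∞} ⟨M_r⟩_n / n^{2r−α} = p_α(r) · ((r−α)^{(r)}/r!) · (Γ(α+θ−r+1)/Γ(θ+1))² · S_{α,θ}, where Γ denotes the Gamma function. -/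

import Mathlib

open MeasureTheory ProbabilityTheory Filter Topology

noncomputable section

/-- Rising factorial `(a)^(m) = a (a+1) ⋯ (a+m-1)` of a real number. -/
def risingFactorial (a : ℝ) : ℕ → ℝ
  | 0 => 1
  | m + 1 => risingFactorial a m * (a + m)

/-- Sibuya probabilities `p_α(r) = α (1-α)^(r-1) / r!` for `r ≥ 1`. -/
def sibuya (α : ℝ) (r : ℕ) : ℝ :=
  α * risingFactorial (1 - α) (r - 1) / (Nat.factorial r : ℝ)

/-- The Ewens–Pitman block-counting chain with parameters `(α, θ)` on a probability space
`(Ω, μ)` with filtration `F`: for `n ≥ 1`, `K n` is the number of blocks and `B r n` the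
number of blocks of size `r` of the Ewens–Pitman random partition of `{1,…,n}`.
It starts from `K 1 = 1`, `B 1 1 = 1`, `B r 1 = 0` for `r ≥ 2`, and the transition from
time `n` to `n+1` creates a new block with conditional probability `(α K n + θ)/(n + θ)`,
and grows a block of size `r` to size `r+1` with conditional probability
`(r - α) B r n / (n + θ)`. -/
structure IsEwensPitman (α θ : ℝ) {Ω : Type*} {mΩ : MeasurableSpace Ω}
    (μ : Measure Ω) (F : Filtration ℕ mΩ) (K : ℕ → Ω → ℕ) (B : ℕ → ℕ → Ω → ℕ) :
    Prop where
  prob : IsProbabilityMeasure μ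
  meas_K : ∀ n, Measurable[F n] (K n)
  meas_B : ∀ r n, Measurable[F n] (B r n)
  init_K : ∀ᵐ ω ∂μ, K 1 ω = 1
  init_B1 : ∀ᵐ ω ∂μ, B 1 1 ω = 1
  init_B : ∀ r, 2 ≤ r → ∀ᵐ ω ∂μ, B r 1 ω = 0
  B_eq_zero : ∀ r n, n < r → ∀ᵐ ω ∂μ, B r n ω = 0
  sum_blocks : ∀ n, 1 ≤ n → ∀ᵐ ω ∂μ, K n ω = ∑ r ∈ Finset.Icc 1 n, B r n ω
  sum_sizes : ∀ n, 1 ≤ n → ∀ᵐ ω ∂μ, n = ∑ r ∈ Finset.Icc 1 n, r * B r n ω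
  trans_new : ∀ n, 1 ≤ n →
    μ[Set.indicator {ω | K (n+1) ω = K n ω + 1 ∧ B 1 (n+1) ω = B 1 n ω + 1 ∧
        ∀ s, 2 ≤ s → B s (n+1) ω = B s n ω} (fun _ => (1:ℝ)) | F n]
      =ᵐ[μ] fun ω => (α * (K n ω : ℝ) + θ) / ((n : ℝ) + θ)
  trans_grow : ∀ n, 1 ≤ n → ∀ r, 1 ≤ r →
    μ[Set.indicator {ω | K (n+1) ω = K n ω ∧ B r (n+1) ω + 1 = B r n ω ∧
        B (r+1) (n+1) ω = B (r+1) n ω + 1 ∧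
        ∀ s, 1 ≤ s → s ≠ r → s ≠ r + 1 → B s (n+1) ω = B s n ω} (fun _ => (1:ℝ)) | F n]
      =ᵐ[μ] fun ω => (((r : ℝ) - α) * (B r n ω : ℝ)) / ((n : ℝ) + θ)

/-- The coefficients `b_{r,i} = (-1)^(r-i) (i-α)^(r-i) / (r-i)!` for `1 ≤ i ≤ r`. -/
def bCoef (α : ℝ) (r i : ℕ) : ℝ :=
  (-1 : ℝ) ^ (r - i) * risingFactorial ((i : ℝ) - α) (r - i) / (Nat.factorial (r - i) : ℝ)

/-- `a_{r,n} = 1` for `n ≤ r` and `a_{r,n} = (θ+1)^(n-1)/(α+θ-r+1)^(n-1)` for `n ≥ r+1`. -/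
def aCoef (α θ : ℝ) (r n : ℕ) : ℝ :=
  if n ≤ r then 1
  else risingFactorial (θ + 1) (n - 1) / risingFactorial (α + θ - (r : ℝ) + 1) (n - 1)

/-- `S_{r,n} = ∑_{i=1}^r b_{r,i} K_{i,n} + (-1)^r p_α(r) K_n`. -/
def Sproc {Ω : Type*} (α : ℝ) (K : ℕ → Ω → ℕ) (B : ℕ → ℕ → Ω → ℕ) (r n : ℕ) (ω : Ω) : ℝ :=
  ∑ i ∈ Finset.Icc 1 r, bCoef α r i * (B i n ω : ℝ) + (-1 : ℝ) ^ r * sibuya α r * (K n ω : ℝ)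

/-- `M_{r,n} = a_{r,n} (S_{r,n} + (-1)^r p_α(r) θ / α)`. -/
def Mmart {Ω : Type*} (α θ : ℝ) (K : ℕ → Ω → ℕ) (B : ℕ → ℕ → Ω → ℕ) (r n : ℕ) (ω : Ω) : ℝ :=
  aCoef α θ r n * (Sproc α K B r n ω + (-1 : ℝ) ^ r * sibuya α r * θ / α)

lemma rf_eq_prod (a : ℝ) (n : ℕ) : risingFactorial a n = ∏ j ∈ Finset.range n, (a + j) := by
  induction n with
  | zero => simp [risingFactorial]
  | succ n ih => rw [Finset.prod_range_succ, ← ih, risingFactorial]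

lemma rf_succ (a : ℝ) (n : ℕ) :
    risingFactorial a (n + 1) = risingFactorial a n * (a + n) := rfl

lemma rf_succ' (a : ℝ) (n : ℕ) :
    risingFactorial a (n + 1) = a * risingFactorial (a + 1) n := by
  rw [rf_eq_prod, rf_eq_prod, Finset.prod_range_succ']
  simp only [Nat.cast_zero, add_zero, Nat.cast_add, Nat.cast_one]
  rw [mul_comm]
  congr 1
  apply Finset.prod_congr rfl
  intros; ring

lemma rf_pos {a : ℝ} (ha : 0 < a) (n : ℕ) : 0 < risingFactorial a n := by
  rw [rf_eq_prod]
  exact Finset.prod_pos (fun i _ => by positivity)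

lemma tendsto_shift_rpow (s : ℝ) :
    Tendsto (fun n : ℕ => ((n : ℝ) / ((n : ℝ) + 1)) ^ s) atTop (𝓝 1) := by
  have h : Tendsto (fun n : ℕ => ((n : ℝ) / ((n : ℝ) + 1))) atTop (𝓝 1) :=
    tendsto_natCast_div_add_atTop (1 : ℝ)
  have := h.rpow_const (p := s) (Or.inl one_ne_zero)
  simpa using this

lemma rf_ratio (a b : ℝ) (ha : 0 < a) :
    Tendsto (fun n : ℕ => risingFactorial a (n - 1) / risingFactorial b (n - 1)
      / (n : ℝ) ^ (a - b)) atTop (𝓝 (Real.Gamma b / Real.Gamma a)) := by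
  have h1 : Tendsto (fun n : ℕ => Real.GammaSeq b n / Real.GammaSeq a n) atTop
      (𝓝 (Real.Gamma b / Real.Gamma a)) :=
    (Real.GammaSeq_tendsto_Gamma b).div (Real.GammaSeq_tendsto_Gamma a)
      (Real.Gamma_pos_of_pos ha).ne'
  have h2 : Tendsto (fun n : ℕ => ((n : ℝ) / ((n : ℝ) + 1)) ^ (a - b) *
      (((n + 1 : ℕ) : ℝ) / (((n + 1 : ℕ) : ℝ) + 1)) ^ (a - b)) atTop (𝓝 1) := by
    have := (tendsto_shift_rpow (a - b)).mul
      ((tendsto_add_atTop_iff_nat (f := fun n : ℕ => ((n : ℝ) / ((n : ℝ) + 1)) ^ (a - b)) 1).2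
        (tendsto_shift_rpow (a - b)))
    simpa using this
  have h3 := h1.mul h2
  rw [mul_one] at h3
  rw [← tendsto_add_atTop_iff_nat 2]
  refine h3.congr' ?_
  filter_upwards [eventually_ge_atTop 1] with n hn
  have hn' : (0 : ℝ) < n := by exact_mod_cast hn
  have e : n + 2 - 1 = n + 1 := by omega
  rw [e, rf_eq_prod, rf_eq_prod, Real.GammaSeq, Real.GammaSeq]
  have hp : (0:ℝ) < ∏ j ∈ Finset.range (n + 1), (a + j) := by
    rw [← rf_eq_prod]; exact rf_pos ha _
  have hf : (0:ℝ) < (n.factorial : ℝ) := by exact_mod_cast n.factorial_pos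
  rw [← Real.mul_rpow (by positivity) (by positivity)]
  have e2 : (n : ℝ) / (n + 1) * (((n + 1 : ℕ) : ℝ) / (((n + 1 : ℕ) : ℝ) + 1))
      = n / ((n + 2 : ℕ) : ℝ) := by
    push_cast
    field_simp
    ring
  rw [e2, Real.div_rpow (by positivity) (by positivity), Real.rpow_sub hn']
  have : (0:ℝ) < (n:ℝ) ^ a := by positivity
  have : (0:ℝ) < (n:ℝ) ^ b := by positivity
  have : (0:ℝ) < ((n + 2 : ℕ):ℝ) ^ (a - b) := by positivity
  field_simp

lemma tendsto_n_one_sub (s : ℝ) :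
    Tendsto (fun n : ℕ => (n : ℝ) * (1 - ((n : ℝ) / ((n : ℝ) + 1)) ^ s)) atTop (𝓝 s) := by
  have hd : HasDerivAt (fun x : ℝ => x ^ s) (s * 1 ^ (s - 1)) 1 :=
    Real.hasDerivAt_rpow_const (Or.inl one_ne_zero)
  rw [Real.one_rpow, mul_one] at hd
  have h1 := hd.tendsto_slope
  have h2 : Tendsto (fun n : ℕ => ((n : ℝ) / ((n : ℝ) + 1))) atTop (𝓝[≠] 1) := by
    rw [tendsto_nhdsWithin_iff]
    refine ⟨tendsto_natCast_div_add_atTop (1 : ℝ), Eventually.of_forall fun n => ?_⟩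
    have : (n : ℝ) + 1 ≠ 0 := by positivity
    intro h
    simp only [Set.mem_singleton_iff] at h
    rw [div_eq_one_iff_eq this] at h
    linarith
  have h3 := (h1.comp h2).mul (tendsto_natCast_div_add_atTop (1 : ℝ))
  rw [mul_one] at h3
  refine h3.congr fun n => ?_
  have : (n : ℝ) + 1 ≠ 0 := by positivity
  simp only [Function.comp, slope_def_field, Real.one_rpow]
  have e : (n : ℝ) / (n + 1) - 1 = - (1 / (n + 1)) := by field_simp; ring
  rw [e]
  field_simp
  ring

lemma contraction_zero (z γ e : ℕ → ℝ) (g : ℝ) (hg : 0 < g)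
    (hz : ∀ᶠ n in atTop, z (n + 1) = (1 - γ n) * z n + γ n * e n)
    (hγ : Tendsto (fun n : ℕ => (n : ℝ) * γ n) atTop (𝓝 g))
    (he : Tendsto e atTop (𝓝 0)) : Tendsto z atTop (𝓝 0) := by
  rw [Metric.tendsto_atTop]
  intro ε hε
  have hγ1 : ∀ᶠ n : ℕ in atTop, g / 2 < n * γ n := hγ.eventually (lt_mem_nhds (by linarith))
  have hγ2 : ∀ᶠ n : ℕ in atTop, n * γ n < 2 * g := hγ.eventually (gt_mem_nhds (by linarith))
  have hγ3 : ∀ᶠ n : ℕ in atTop, 2 * g ≤ (n : ℝ) :=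
    tendsto_natCast_atTop_atTop.eventually (eventually_ge_atTop (2 * g))
  have he1 : ∀ᶠ n in atTop, |e n| < ε / 2 := by
    have := he.abs
    rw [abs_zero] at this
    exact this.eventually (gt_mem_nhds (by linarith))
  obtain ⟨N, hN⟩ := eventually_atTop.1 (hz.and (hγ1.and (hγ2.and (hγ3.and
    (he1.and (eventually_ge_atTop 1))))))
  set u : ℕ → ℝ := fun n => max (|z n| - ε / 2) 0 with hu
  have hu0 : ∀ n, 0 ≤ u n := fun n => le_max_right _ _
  have hstep : ∀ n, N ≤ n → u (n + 1) ≤ (1 - γ n) * u n ∧ g / 2 / n ≤ γ n := by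
    intro n hn
    obtain ⟨h1, h2, h3, h4, h5, h6⟩ := hN n hn
    have hn0 : (0:ℝ) < n := by exact_mod_cast h6
    have hγp : g / 2 / n ≤ γ n := by
      rw [div_le_iff₀ hn0]; linarith
    have hγ0 : 0 ≤ γ n := le_trans (by positivity) hγp
    have hγl : γ n ≤ 1 := by
      by_contra hc
      push Not at hc
      nlinarith
    refine ⟨?_, hγp⟩
    have hle : |z n| - ε / 2 ≤ u n := le_max_left _ _
    apply max_le
    · rw [h1]
      have : |(1 - γ n) * z n + γ n * e n| ≤ (1 - γ n) * |z n| + γ n * |e n| := by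
        refine (abs_add_le _ _).trans ?_
        rw [abs_mul, abs_mul, abs_of_nonneg hγ0, abs_of_nonneg (by linarith : 0 ≤ 1 - γ n)]
      have : γ n * |e n| ≤ γ n * (ε / 2) := mul_le_mul_of_nonneg_left h5.le hγ0
      have : (1 - γ n) * (|z n| - ε / 2) ≤ (1 - γ n) * u n :=
        mul_le_mul_of_nonneg_left hle (by linarith)
      linarith
    · exact mul_nonneg (by linarith) (hu0 n)
  have hbound : ∀ m, u (N + m) ≤
      u N * Real.exp (-(g / 2 * ∑ k ∈ Finset.range m, 1 / ((N + k : ℕ) : ℝ))) := by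
    intro m
    induction m with
    | zero => simp
    | succ m ih =>
      obtain ⟨h1, h2⟩ := hstep (N + m) (by omega)
      rw [Finset.sum_range_succ, mul_add, neg_add, Real.exp_add, ← mul_assoc]
      have h3 : 1 - γ (N + m) ≤ Real.exp (-(g / 2 * (1 / ((N + m : ℕ) : ℝ)))) := by
        have := Real.add_one_le_exp (-(g / 2 * (1 / ((N + m : ℕ) : ℝ))))
        have e : g / 2 * (1 / ((N + m : ℕ) : ℝ)) = g / 2 / ((N + m : ℕ) : ℝ) := by ring
        rw [e] at this ⊢
        linarith
      calc u (N + (m + 1)) ≤ (1 - γ (N + m)) * u (N + m) := h1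
        _ ≤ Real.exp (-(g / 2 * (1 / ((N + m : ℕ) : ℝ)))) * u (N + m) :=
          mul_le_mul_of_nonneg_right h3 (hu0 _)
        _ ≤ Real.exp (-(g / 2 * (1 / ((N + m : ℕ) : ℝ)))) * _ :=
          mul_le_mul_of_nonneg_left ih (Real.exp_pos _).le
        _ = _ := by ring
  have hdiv : Tendsto (fun m => ∑ k ∈ Finset.range m, 1 / ((N + k : ℕ) : ℝ)) atTop atTop := by
    have hns : ¬ Summable (fun k : ℕ => 1 / ((N + k : ℕ) : ℝ)) := by
      have := (summable_nat_add_iff (f := fun n : ℕ => 1 / (n : ℝ)) N).not.2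
        Real.not_summable_one_div_natCast
      simpa [add_comm] using this
    exact (not_summable_iff_tendsto_nat_atTop_of_nonneg (fun k => by positivity)).1 hns
  have hlim : Tendsto (fun m => u N *
      Real.exp (-(g / 2 * ∑ k ∈ Finset.range m, 1 / ((N + k : ℕ) : ℝ)))) atTop (𝓝 0) := by
    have : Tendsto (fun m => Real.exp (-(g / 2 * ∑ k ∈ Finset.range m, 1 / ((N + k : ℕ) : ℝ))))
        atTop (𝓝 0) :=
      Real.tendsto_exp_neg_atTop_nhds_zero.comp (hdiv.const_mul_atTop (by positivity))
    simpa using this.const_mul (u N)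
  obtain ⟨M, hM⟩ := eventually_atTop.1 (hlim.eventually (gt_mem_nhds (half_pos hε)))
  refine ⟨N + M, fun n hn => ?_⟩
  obtain ⟨m, rfl⟩ : ∃ m, n = N + m := ⟨n - N, by omega⟩
  have h1 := hM m (by omega)
  have h2 := hbound m
  have h3 : |z (N + m)| - ε / 2 ≤ u (N + m) := le_max_left _ _
  rw [Real.dist_eq, sub_zero]
  linarith

lemma contraction (z γ e : ℕ → ℝ) (g L : ℝ) (hg : 0 < g)
    (hz : ∀ᶠ n in atTop, z (n + 1) = (1 - γ n) * z n + γ n * e n)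
    (hγ : Tendsto (fun n : ℕ => (n : ℝ) * γ n) atTop (𝓝 g))
    (he : Tendsto e atTop (𝓝 L)) : Tendsto z atTop (𝓝 L) := by
  have := contraction_zero (fun n => z n - L) γ (fun n => e n - L) g hg
    (by filter_upwards [hz] with n hn; rw [hn]; ring) hγ (by simpa using he.sub_const L)
  simpa using this.add_const L

/-- Deterministic recursion lemma. -/
lemma recursion_limit (x d ξ : ℕ → ℝ) (c θ s D : ℝ) (hcs : 0 < c + s)
    (hx : ∀ᶠ n : ℕ in atTop, x (n + 1) = x n * (1 - c / (n + θ)) + d n / (n + θ) + ξ n)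
    (hξ : ∃ T, Tendsto (fun n : ℕ => ∑ k ∈ Finset.range n, ξ k / ((k : ℝ) + 1) ^ s) atTop (𝓝 T))
    (hd : Tendsto (fun n : ℕ => d n / (n : ℝ) ^ s) atTop (𝓝 D)) :
    Tendsto (fun n : ℕ => x n / (n : ℝ) ^ s) atTop (𝓝 (D / (c + s))) := by
  obtain ⟨T, hT⟩ := hξ
  set Tn : ℕ → ℝ := fun n => ∑ k ∈ Finset.range n, ξ k / ((k : ℝ) + 1) ^ s with hTn
  set R : ℕ → ℝ := fun n => ((n : ℝ) / ((n : ℝ) + 1)) ^ s with hR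
  set γ : ℕ → ℝ := fun n => 1 - R n * (1 - c / (n + θ)) with hγd
  set f : ℕ → ℝ := fun n => R n * (d n / (n : ℝ) ^ s) / (n + θ) with hf
  have hRl : Tendsto R atTop (𝓝 1) := tendsto_shift_rpow s
  have hnθ : Tendsto (fun n : ℕ => (n : ℝ) / (n + θ)) atTop (𝓝 1) :=
    tendsto_natCast_div_add_atTop θ
  have hγ : Tendsto (fun n : ℕ => (n : ℝ) * γ n) atTop (𝓝 (c + s)) := by
    have h := (tendsto_n_one_sub s).add ((hRl.mul hnθ).mul_const c)
    have e : s + 1 * 1 * c = c + s := by ring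
    rw [e] at h
    refine h.congr fun n => ?_
    simp only [hγd, hR]
    ring
  have hγne : ∀ᶠ n in atTop, γ n ≠ 0 := by
    filter_upwards [hγ.eventually (lt_mem_nhds hcs)] with n hn h0
    rw [h0] at hn; simp at hn
  have hfl : Tendsto (fun n : ℕ => (n : ℝ) * f n) atTop (𝓝 D) := by
    have h := (hRl.mul hd).mul hnθ
    rw [one_mul, mul_one] at h
    refine h.congr fun n => ?_
    simp only [hf]; ring
  have he : Tendsto (fun n : ℕ => ((n : ℝ) * f n) / (n * γ n) - (Tn n - T)) atTop
      (𝓝 (D / (c + s))) := by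
    have h := (hfl.div hγ hcs.ne').sub (hT.sub_const T)
    simpa using h
  have key := contraction (fun n => x n / (n : ℝ) ^ s - Tn n + T) γ _ (c + s) (D / (c + s)) hcs
    ?_ hγ he
  · have := key.add (hT.sub_const T)
    simp only [sub_self, add_zero] at this
    refine this.congr fun n => ?_
    ring
  · filter_upwards [hx, hγne, eventually_ge_atTop 1] with n hn hg hn1
    have hn0 : (0:ℝ) < n := by exact_mod_cast hn1
    have hTs : Tn (n + 1) = Tn n + ξ n / ((n : ℝ) + 1) ^ s := by
      simp only [hTn, Finset.sum_range_succ]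
    have hRn : R n = (n : ℝ) ^ s / ((n : ℝ) + 1) ^ s := by
      simp only [hR]; rw [Real.div_rpow (by positivity) (by positivity)]
    have e1 : γ n * ((n : ℝ) * f n / (n * γ n) - (Tn n - T)) = f n - γ n * (Tn n - T) := by
      field_simp
    rw [e1, hn, hTs]
    have p1 : (0:ℝ) < (n : ℝ) ^ s := by positivity
    have p2 : (0:ℝ) < ((n : ℝ) + 1) ^ s := by positivity
    have e2 : f n = d n / (n + θ) / ((n : ℝ) + 1) ^ s := by
      simp only [hf, hRn]
      rw [div_mul_div_comm, mul_comm (((n : ℝ) + 1) ^ s), ← div_mul_div_comm, div_self p1.ne',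
        one_mul]
      ring
    rw [e2]
    have e3 : (1 - γ n) = (n : ℝ) ^ s / ((n : ℝ) + 1) ^ s * (1 - c / (n + θ)) := by
      simp only [hγd, hRn]; ring
    have e4 : γ n = 1 - (n : ℝ) ^ s / ((n : ℝ) + 1) ^ s * (1 - c / (n + θ)) := by
      linarith
    rw [e3, e4]
    have e5 : ((n + 1 : ℕ) : ℝ) = (n : ℝ) + 1 := by push_cast; ring
    rw [e5]
    generalize 1 - c / (n + θ) = w
    generalize d n / (n + θ) = v
    field_simp
    ring

lemma cesaro_rpow (v : ℕ → ℝ) (s L : ℝ) (hs : 0 < s)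
    (hv : Tendsto (fun n : ℕ => v n / (n : ℝ) ^ (s - 1)) atTop (𝓝 L)) :
    Tendsto (fun n : ℕ => (∑ k ∈ Finset.Icc 1 (n - 1), v k) / (n : ℝ) ^ s) atTop (𝓝 (L / s)) := by
  have := recursion_limit (fun n => ∑ k ∈ Finset.Icc 1 (n - 1), v k) (fun n => n * v n)
    (fun _ => 0) 0 0 s L (by linarith) ?_ ⟨0, by simp⟩ ?_
  · simpa using this
  · filter_upwards [eventually_ge_atTop 1] with n hn
    have hn0 : (n : ℝ) ≠ 0 := by positivity
    obtain ⟨m, rfl⟩ : ∃ m, n = m + 1 := ⟨n - 1, by omega⟩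
    simp only [Nat.add_sub_cancel]
    rw [Finset.sum_Icc_succ_top (by omega)]
    field_simp
    simp
    ring
  · refine hv.congr' ?_
    filter_upwards [eventually_ge_atTop 1] with n hn
    have hn0 : (0:ℝ) < n := by exact_mod_cast hn
    rw [Real.rpow_sub_one hn0.ne']
    have : (0:ℝ) < (n : ℝ) ^ s := by positivity
    field_simp

def dl (α : ℝ) (r j : ℕ) : ℝ :=
  if j ≤ r then -((-1 : ℝ) ^ (r - j) * risingFactorial ((j : ℝ) + 1 - α) (r - j) /
    (Nat.factorial (r - j) : ℝ)) else 0

def rho (α : ℝ) (j : ℕ) : ℝ := α * risingFactorial (1 - α) j / (Nat.factorial j : ℝ)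

lemma choose_rf (y : ℝ) (k : ℕ) :
    Ring.choose y k = risingFactorial (y - k + 1) k / (Nat.factorial k : ℝ) := by
  have hf : (0:ℝ) < (k.factorial : ℝ) := by exact_mod_cast k.factorial_pos
  have h := Ring.descPochhammer_eq_factorial_smul_choose y k
  rw [eq_div_iff hf.ne', mul_comm]
  rw [nsmul_eq_mul] at h
  rw [← h, rf_eq_prod, ← Polynomial.aeval_eq_smeval, Polynomial.aeval_def,
    Polynomial.eval₂_eq_eval_map, descPochhammer_map, descPochhammer_eval_eq_prod_range,
    ← Finset.prod_range_reflect]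
  apply Finset.prod_congr rfl
  intro j hj
  rw [Finset.mem_range] at hj
  have : ((k - 1 - j : ℕ) : ℝ) = k - 1 - j := by
    rw [Nat.cast_sub (by omega), Nat.cast_sub (by omega)]; simp
  rw [this]; ring

lemma dl_step (α : ℝ) (r j : ℕ) (h : j < r) :
    bCoef α r (j + 1) - bCoef α r j = dl α r j := by
  obtain ⟨m, rfl⟩ : ∃ m, r = j + m + 1 := ⟨r - j - 1, by omega⟩
  have e1 : j + m + 1 - (j + 1) = m := by omega
  have e2 : j + m + 1 - j = m + 1 := by omega
  rw [dl, if_pos h.le, bCoef, bCoef, e1, e2, rf_succ' ((j:ℝ) - α), rf_succ,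
    Nat.factorial_succ]
  have hf : (0:ℝ) < (m.factorial : ℝ) := by exact_mod_cast m.factorial_pos
  have e3 : (j : ℝ) - α + 1 = (j : ℝ) + 1 - α := by ring
  rw [e3]
  push_cast
  field_simp
  ring

lemma dl_zero (α : ℝ) (r : ℕ) (h : 1 ≤ r) :
    bCoef α r 1 + (-1 : ℝ) ^ r * sibuya α r = dl α r 0 := by
  rw [← dl_step α r 0 (by omega)]
  obtain ⟨m, rfl⟩ : ∃ m, r = m + 1 := ⟨r - 1, by omega⟩
  simp only [bCoef, sibuya, Nat.add_sub_cancel, Nat.sub_zero, zero_add, rf_succ' (((0:ℕ):ℝ) - α)]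
  have : ((0:ℕ):ℝ) - α + 1 = 1 - α := by simp; ring
  rw [this]
  simp
  ring

lemma dl_top (α : ℝ) (r : ℕ) : - bCoef α r r = dl α r r := by
  simp [dl, bCoef, risingFactorial]

lemma rho_succ (α : ℝ) (j : ℕ) : (((j + 1 : ℕ) : ℝ) - α) * sibuya α (j + 1) = rho α (j + 1) := by
  simp only [sibuya, rho, Nat.add_sub_cancel, rf_succ]
  push_cast
  ring

lemma rf_split (a : ℝ) (i m : ℕ) :
    risingFactorial a (i + m) = risingFactorial a i * risingFactorial (a + i) m := by
  rw [rf_eq_prod, rf_eq_prod, rf_eq_prod, Finset.prod_range_add]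
  congr 1
  apply Finset.prod_congr rfl
  intros; push_cast; ring

lemma comb_identity (α : ℝ) (r : ℕ) (hr : 1 ≤ r) :
    ∑ j ∈ Finset.range (r + 1), rho α j * dl α r j ^ 2
      = (2 * r - α) * (sibuya α r * (risingFactorial ((r : ℝ) - α) r / (Nat.factorial r : ℝ))) := by
  have hf : ∀ k : ℕ, (0:ℝ) < (k.factorial : ℝ) := fun k => by exact_mod_cast k.factorial_pos
  have hV := Ring.add_choose_eq (r := (r : ℝ)) (s := (r : ℝ) - α) r (Commute.all _ _)
  rw [Finset.Nat.sum_antidiagonal_eq_sum_range_succ_mk] at hV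
  have h1 : ∀ j ∈ Finset.range (r + 1), rho α j * dl α r j ^ 2 =
      α * risingFactorial (1 - α) r / (Nat.factorial r : ℝ) *
        (Ring.choose (r : ℝ) j * Ring.choose ((r : ℝ) - α) (r - j)) := by
    intro j hj
    have hj' : j ≤ r := by rw [Finset.mem_range] at hj; omega
    obtain ⟨m, rfl⟩ : ∃ m, r = j + m := ⟨r - j, by omega⟩
    rw [dl, if_pos hj', rho, Ring.choose_natCast, choose_rf, Nat.add_sub_cancel_left, rf_split,
      Nat.cast_add_choose]
    have e1 : ((j + m : ℕ) : ℝ) - α - m + 1 = j + 1 - α := by push_cast; ring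
    have e2 : 1 - α + (j : ℝ) = j + 1 - α := by ring
    rw [e1, e2]
    have := hf j
    have := hf m
    have := hf (j + m)
    have e3 : ((-1 : ℝ) ^ m) ^ 2 = 1 := by rw [← pow_mul, mul_comm, pow_mul]; simp
    have e4 : ∀ R M : ℝ, (-((-1 : ℝ) ^ m * R / M)) ^ 2 = R ^ 2 / M ^ 2 := by
      intro R M
      rw [neg_sq, div_pow, mul_pow, e3, one_mul]
    rw [e4]
    field_simp
  rw [Finset.sum_congr rfl h1, ← Finset.mul_sum, ← hV, choose_rf]
  obtain ⟨m, rfl⟩ : ∃ m, r = m + 1 := ⟨r - 1, by omega⟩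
  have e1 : ((m + 1 : ℕ) : ℝ) + (((m + 1 : ℕ) : ℝ) - α) - ((m + 1 : ℕ) : ℝ) + 1
    = ((m + 1 : ℕ) : ℝ) - α + 1 := by ring
  rw [e1, rf_succ (((m + 1 : ℕ) : ℝ) - α + 1), rf_succ' (((m + 1 : ℕ) : ℝ) - α), sibuya,
    rf_succ, Nat.add_sub_cancel]
  push_cast
  ring

def Ev {Ω : Type*} (K : ℕ → Ω → ℕ) (B : ℕ → ℕ → Ω → ℕ) (n : ℕ) : ℕ → Set Ω
  | 0 => {ω | K (n+1) ω = K n ω + 1 ∧ B 1 (n+1) ω = B 1 n ω + 1 ∧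
        ∀ s, 2 ≤ s → B s (n+1) ω = B s n ω}
  | (r + 1) => {ω | K (n+1) ω = K n ω ∧ B (r+1) (n+1) ω + 1 = B (r+1) n ω ∧
        B (r+1+1) (n+1) ω = B (r+1+1) n ω + 1 ∧
        ∀ s, 1 ≤ s → s ≠ r + 1 → s ≠ r + 1 + 1 → B s (n+1) ω = B s n ω}

def qv {Ω : Type*} (α θ : ℝ) (K : ℕ → Ω → ℕ) (B : ℕ → ℕ → Ω → ℕ) (n : ℕ) : ℕ → Ω → ℝ
  | 0 => fun ω => (α * (K n ω : ℝ) + θ) / ((n : ℝ) + θ)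
  | (r + 1) => fun ω => ((((r + 1 : ℕ) : ℝ) - α) * (B (r + 1) n ω : ℝ)) / ((n : ℝ) + θ)

section
variable {α θ : ℝ} {Ω : Type*} [mΩ : MeasurableSpace Ω] {μ : Measure Ω} {F : Filtration ℕ mΩ}
    {K : ℕ → Ω → ℕ} {B : ℕ → ℕ → Ω → ℕ}

lemma ep_condExp_ev (h : IsEwensPitman α θ μ F K B) (n : ℕ) (hn : 1 ≤ n) (j : ℕ) :
    μ[Set.indicator (Ev K B n j) (fun _ => (1:ℝ)) | F n] =ᵐ[μ] qv α θ K B n j := by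
  cases j with
  | zero => exact h.trans_new n hn
  | succ r => exact h.trans_grow n hn (r + 1) (by omega)

lemma ep_meas_K (h : IsEwensPitman α θ μ F K B) {m n : ℕ} (hmn : m ≤ n) :
    Measurable[F n] (K m) := (h.meas_K m).mono (F.mono hmn) le_rfl

lemma ep_meas_B (h : IsEwensPitman α θ μ F K B) (r : ℕ) {m n : ℕ} (hmn : m ≤ n) :
    Measurable[F n] (B r m) := (h.meas_B r m).mono (F.mono hmn) le_rfl

lemma ep_meas_ev (h : IsEwensPitman α θ μ F K B) (n j : ℕ) :
    MeasurableSet (Ev K B n j) := by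
  have hK : ∀ m, Measurable (K m) := fun m => (h.meas_K m).mono (F.le m) le_rfl
  have hB : ∀ r m, Measurable (B r m) := fun r m => (h.meas_B r m).mono (F.le m) le_rfl
  have key : ∀ (f g : Ω → ℕ), Measurable f → Measurable g → MeasurableSet {ω | f ω = g ω} :=
    fun f g hf hg => measurableSet_eq_fun hf hg
  cases j with
  | zero =>
    refine (key _ _ (hK _) ((hK _).add_const 1)).inter
      ((key _ _ (hB _ _) ((hB _ _).add_const 1)).inter ?_)
    have : {ω | ∀ s, 2 ≤ s → B s (n+1) ω = B s n ω} =
        ⋂ s, ⋂ (_ : 2 ≤ s), {ω | B s (n+1) ω = B s n ω} := by ext; simp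
    change MeasurableSet {ω | ∀ s, 2 ≤ s → B s (n+1) ω = B s n ω}
    rw [this]
    exact MeasurableSet.iInter fun s => MeasurableSet.iInter fun _ => key _ _ (hB _ _) (hB _ _)
  | succ r =>
    refine (key _ _ (hK _) (hK _)).inter ((key _ _ ((hB _ _).add_const 1) (hB _ _)).inter
      ((key _ _ (hB _ _) ((hB _ _).add_const 1)).inter ?_))
    have : {ω | ∀ s, 1 ≤ s → s ≠ r + 1 → s ≠ r + 1 + 1 → B s (n+1) ω = B s n ω} =
        ⋂ s, ⋂ (_ : 1 ≤ s), ⋂ (_ : s ≠ r + 1), ⋂ (_ : s ≠ r + 1 + 1),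
          {ω | B s (n+1) ω = B s n ω} := by ext; simp
    change MeasurableSet {ω | ∀ s, 1 ≤ s → s ≠ r + 1 → s ≠ r + 1 + 1 → B s (n+1) ω = B s n ω}
    rw [this]
    exact MeasurableSet.iInter fun s => MeasurableSet.iInter fun _ => MeasurableSet.iInter
      fun _ => MeasurableSet.iInter fun _ => key _ _ (hB _ _) (hB _ _)

lemma ev_disj (n j k : ℕ) (hjk : j < k) (ω : Ω) (h1 : ω ∈ Ev K B n j) : ω ∉ Ev K B n k := by
  intro h2
  obtain ⟨k, rfl⟩ : ∃ m, k = m + 1 := ⟨k - 1, by omega⟩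
  obtain ⟨a1, a2, a3, a4⟩ := h2
  cases j with
  | zero =>
    obtain ⟨b1, b2, b3⟩ := h1
    omega
  | succ r =>
    obtain ⟨b1, b2, b3, b4⟩ := h1
    have := a4 (r + 1) (by omega) (by omega) (by omega)
    omega

lemma ev_unique (n j k : ℕ) (ω : Ω) (h1 : ω ∈ Ev K B n j) (h2 : ω ∈ Ev K B n k) : j = k := by
  rcases lt_trichotomy j k with h | h | h
  · exact absurd h2 (ev_disj n j k h ω h1)
  · exact h
  · exact absurd h1 (ev_disj n k j h ω h2)

lemma ep_bounds (h : IsEwensPitman α θ μ F K B) (n : ℕ) (hn : 1 ≤ n) :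
    ∀ᵐ ω ∂μ, 1 ≤ K n ω ∧ K n ω ≤ n ∧ (∀ r, 1 ≤ r → B r n ω ≤ K n ω) ∧
      (∀ r, n < r → B r n ω = 0) := by
  filter_upwards [h.sum_blocks n hn, h.sum_sizes n hn, ae_all_iff.2 (fun r => ae_all_iff.2
    (fun hr => h.B_eq_zero r n hr))] with ω h1 h2 h3
  refine ⟨?_, ?_, ?_, h3⟩
  · by_contra hc
    have h0 : ∑ r ∈ Finset.Icc 1 n, B r n ω = 0 := by omega
    rw [Finset.sum_eq_zero_iff] at h0
    rw [Finset.sum_eq_zero (fun r hr => by rw [h0 r hr, mul_zero])] at h2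
    omega
  · rw [h1]
    conv_rhs => rw [h2]
    apply Finset.sum_le_sum
    intro r hr
    rw [Finset.mem_Icc] at hr
    exact Nat.le_mul_of_pos_left _ (by omega)
  · intro r hr
    by_cases hrn : r ≤ n
    · rw [h1]
      exact Finset.single_le_sum (f := fun r => B r n ω) (fun _ _ => Nat.zero_le _)
        (Finset.mem_Icc.2 ⟨hr, hrn⟩)
    · rw [h3 r (by omega)]; exact Nat.zero_le _

lemma ep_q_sum (h : IsEwensPitman α θ μ F K B) (hα1 : α < 1) (hθ : 0 < α + θ)
    (n : ℕ) (hn : 1 ≤ n) :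
    ∀ᵐ ω ∂μ, ∑ j ∈ Finset.range (n + 1), qv α θ K B n j ω = 1 := by
  filter_upwards [h.sum_blocks n hn, h.sum_sizes n hn] with ω h1 h2
  have hn1 : (1:ℝ) ≤ n := by exact_mod_cast hn
  have hpos : (n : ℝ) + θ ≠ 0 := by linarith
  rw [Finset.sum_range_succ']
  simp only [qv]
  rw [← Finset.sum_div, ← add_div, div_eq_one_iff_eq hpos]
  have e : ∑ i ∈ Finset.range n, (((i + 1 : ℕ) : ℝ) - α) * (B (i + 1) n ω : ℝ)
      = ∑ r ∈ Finset.Icc 1 n, ((r : ℝ) - α) * (B r n ω : ℝ) := by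
    have hI : Finset.Icc 1 n = Finset.Ico 1 (n + 1) := by ext; simp
    rw [hI, Finset.sum_Ico_eq_sum_range]
    apply Finset.sum_congr (by simp)
    intro i _
    rw [add_comm 1 i]
  rw [e]
  have h1' : (K n ω : ℝ) = ∑ r ∈ Finset.Icc 1 n, (B r n ω : ℝ) := by exact_mod_cast h1
  have h2' : (n : ℝ) = ∑ r ∈ Finset.Icc 1 n, (r : ℝ) * (B r n ω : ℝ) := by exact_mod_cast h2
  simp only [sub_mul, Finset.sum_sub_distrib, ← Finset.mul_sum]
  rw [← h1', ← h2']
  ring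

lemma ep_ev_ae (h : IsEwensPitman α θ μ F K B) (hα1 : α < 1) (hθ : 0 < α + θ)
    (n : ℕ) (hn : 1 ≤ n) :
    ∀ᵐ ω ∂μ, ∃ j ≤ n, ω ∈ Ev K B n j := by
  have := h.prob
  set f : Ω → ℝ := fun ω => ∑ j ∈ Finset.range (n + 1),
    Set.indicator (Ev K B n j) (fun _ => (1:ℝ)) ω with hf
  have hint : ∀ j, Integrable (Set.indicator (Ev K B n j) (fun _ => (1:ℝ))) μ := fun j =>
    (integrable_const 1).indicator (ep_meas_ev h n j)
  have hfint : Integrable f μ := integrable_finsetSum _ (fun j _ => hint j)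
  have hle : ∀ ω, f ω ≤ 1 := by
    intro ω
    by_cases hex : ∃ j ∈ Finset.range (n + 1), ω ∈ Ev K B n j
    · obtain ⟨j, hj, hω⟩ := hex
      simp only [hf]
      rw [Finset.sum_eq_single_of_mem j hj, Set.indicator_of_mem hω]
      intro k _ hk
      exact Set.indicator_of_notMem (fun hk' => hk (ev_unique n k j ω hk' hω)) _
    · push Not at hex
      simp only [hf]
      rw [Finset.sum_eq_zero (fun j hj => Set.indicator_of_notMem (hex j hj) _)]
      norm_num
  have hI : ∫ ω, f ω ∂μ = 1 := by
    simp only [hf]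
    rw [integral_finsetSum _ (fun j _ => hint j)]
    have : ∀ j, ∫ ω, Set.indicator (Ev K B n j) (fun _ => (1:ℝ)) ω ∂μ
        = ∫ ω, qv α θ K B n j ω ∂μ := by
      intro j
      rw [← integral_condExp (F.le n)]
      exact integral_congr_ae (ep_condExp_ev h n hn j)
    simp only [this]
    rw [← integral_finsetSum]
    · rw [integral_congr_ae (ep_q_sum h hα1 hθ n hn)]; simp
    · intro j _
      exact integrable_condExp.congr (ep_condExp_ev h n hn j)
  have h0 : (fun ω => 1 - f ω) =ᵐ[μ] 0 := by
    refine (integral_eq_zero_iff_of_nonneg (fun ω => by simpa using hle ω)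
      ((integrable_const 1).sub hfint)).1 ?_
    simp only [Pi.sub_apply]
    rw [integral_sub (integrable_const 1) hfint, hI]; simp
  filter_upwards [h0] with ω hω
  by_contra hc
  push Not at hc
  have : f ω = 0 := by
    simp only [hf]
    apply Finset.sum_eq_zero
    intro j hj
    exact Set.indicator_of_notMem (hc j (by rw [Finset.mem_range] at hj; omega)) _
  simp [this] at hω

/-- Conditional expectation of a one-step quantity. -/
lemma ep_step (h : IsEwensPitman α θ μ F K B) (hα1 : α < 1) (hθ : 0 < α + θ)
    (n : ℕ) (hn : 1 ≤ n) (G : ℕ → Ω → ℝ) (X : Ω → ℝ)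
    (hG : ∀ j, StronglyMeasurable[F n] (G j)) (hGi : ∀ j, Integrable (G j) μ)
    (hX : ∀ᵐ ω ∂μ, ∀ j ≤ n, ω ∈ Ev K B n j → X ω = G j ω) :
    Integrable X μ ∧
    μ[X | F n] =ᵐ[μ] fun ω => ∑ j ∈ Finset.range (n + 1), G j ω * qv α θ K B n j ω := by
  have := h.prob
  set I : ℕ → Ω → ℝ := fun j => Set.indicator (Ev K B n j) (fun _ => (1:ℝ)) with hI
  have hint : ∀ j, Integrable (I j) μ := fun j =>
    (integrable_const 1).indicator (ep_meas_ev h n j)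
  have hGI : ∀ j, G j * I j = Set.indicator (Ev K B n j) (G j) := by
    intro j
    ext ω
    by_cases hω : ω ∈ Ev K B n j <;> simp [hI, hω]
  have hint2 : ∀ j, Integrable (G j * I j) μ := by
    intro j
    rw [hGI]
    exact (hGi j).indicator (ep_meas_ev h n j)
  have hXe : X =ᵐ[μ] ∑ j ∈ Finset.range (n + 1), G j * I j := by
    filter_upwards [hX, ep_ev_ae h hα1 hθ n hn] with ω h1 ⟨j, hj, hω⟩
    rw [h1 j hj hω, Finset.sum_apply, Finset.sum_eq_single_of_mem j (Finset.mem_range.2 (by omega))]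
    · simp [hI, hω]
    · intro k _ hk
      have : ω ∉ Ev K B n k := fun hk' => hk (ev_unique n k j ω hk' hω)
      simp [hI, this]
  refine ⟨(integrable_finsetSum' _ (fun j _ => hint2 j)).congr hXe.symm, ?_⟩
  refine (condExp_congr_ae hXe).trans ((condExp_finsetSum (fun j _ => hint2 j) (F n)).trans ?_)
  have h2 : ∀ᵐ ω ∂μ, ∀ j, (μ[G j * I j | F n]) ω = G j ω * qv α θ K B n j ω := by
    rw [ae_all_iff]
    intro j
    filter_upwards [condExp_mul_of_stronglyMeasurable_left (hG j) (hint2 j) (hint j),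
      ep_condExp_ev h n hn j] with ω e1 e2
    rw [e1, Pi.mul_apply, e2]
  filter_upwards [h2] with ω hω
  rw [Finset.sum_apply]
  exact Finset.sum_congr rfl (fun j _ => hω j)

/-- increments of B -/
lemma ev_B (n j r : ℕ) (hr : 1 ≤ r) (ω : Ω) (hω : ω ∈ Ev K B n j) :
    (B r (n + 1) ω : ℝ) = B r n ω + ((if r = j + 1 then 1 else 0) - (if r = j then 1 else 0)) := by
  cases j with
  | zero =>
    obtain ⟨b1, b2, b3⟩ := hω
    by_cases h1 : r = 1
    · subst h1; rw [b2]; push_cast; simp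
    · rw [b3 r (by omega)]
      rw [if_neg (by omega), if_neg (by omega)]; ring
  | succ m =>
    obtain ⟨b1, b2, b3, b4⟩ := hω
    by_cases h1 : r = m + 1
    · subst h1
      rw [← b2, if_neg (by omega), if_pos rfl]; push_cast; ring
    · by_cases h2 : r = m + 1 + 1
      · subst h2
        rw [b3, if_pos rfl, if_neg (by omega)]; push_cast; ring
      · rw [b4 r hr h1 h2, if_neg (by omega), if_neg (by omega)]; ring

lemma ev_K (n j : ℕ) (ω : Ω) (hω : ω ∈ Ev K B n j) :
    K (n + 1) ω = K n ω + (if j = 0 then 1 else 0) := by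
  cases j with
  | zero => exact hω.1
  | succ m => simpa using hω.1
end

section
variable {α θ : ℝ} {Ω : Type*} [mΩ : MeasurableSpace Ω] {μ : Measure Ω} {F : Filtration ℕ mΩ}
    {K : ℕ → Ω → ℕ} {B : ℕ → ℕ → Ω → ℕ}

def shiftF (F : Filtration ℕ mΩ) : Filtration ℕ mΩ where
  seq n := F (n + 1)
  mono' := fun _ _ h => F.mono (by omega)
  le' := fun n => F.le (n + 1)

lemma mart_conv [IsProbabilityMeasure μ] (G : Filtration ℕ mΩ) (Y : ℕ → Ω → ℝ)
    (hY : ∀ n, StronglyMeasurable[G n] (Y n)) (hi : ∀ n, Integrable (Y n) μ)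
    (hm : ∀ n, μ[Y (n + 1) | G n] =ᵐ[μ] Y n) (R : ℝ) (hR : ∀ n, ∫ ω, |Y n ω| ∂μ ≤ R) :
    ∀ᵐ ω ∂μ, ∃ c, Tendsto (fun n => Y n ω) atTop (𝓝 c) := by
  have hM : Martingale Y G μ := martingale_nat hY hi (fun n => (hm n).symm)
  refine hM.submartingale.exists_ae_tendsto_of_bdd (R := R.toNNReal) fun n => ?_
  rw [eLpNorm_one_eq_lintegral_enorm, ← ofReal_integral_norm_eq_lintegral_enorm (hi n)]
  exact ENNReal.ofReal_le_ofReal (hR n)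

lemma ep_int_fK (h : IsEwensPitman α θ μ F K B) (f : ℕ → ℝ) (n : ℕ) (hn : 1 ≤ n) (m : ℕ) :
    Integrable (fun ω => f (K n ω + m)) μ := by
  have := h.prob
  have hK : Measurable (K n) := (h.meas_K n).mono (F.le n) le_rfl
  refine Integrable.of_bound (C := ∑ k ∈ Finset.range (n + m + 1), |f k|) ?_ ?_
  · exact ((measurable_of_countable (fun k : ℕ => f (k + m))).comp hK).aestronglyMeasurable
  · filter_upwards [ep_bounds h n hn] with ω hω
    rw [Real.norm_eq_abs]
    exact Finset.single_le_sum (f := fun k => |f k|) (fun _ _ => abs_nonneg _)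
      (Finset.mem_range.2 (by omega))

lemma ep_K_mart (h : IsEwensPitman α θ μ F K B) (hα1 : α < 1) (hθ : 0 < α + θ)
    (f : ℕ → ℝ) (l : ℝ) (hl : 0 < 1 + θ + l) (hf : ∀ k, 1 ≤ k → 0 ≤ f k)
    (hrec : ∀ k : ℕ, 1 ≤ k → (f (k + 1) - f k) * (α * k + θ) = l * f k) :
    (∀ᵐ ω ∂μ, ∃ c, Tendsto (fun n => f (K n ω) *
      (risingFactorial (1 + θ) (n - 1) / risingFactorial (1 + θ + l) (n - 1))) atTop (𝓝 c)) ∧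
    ∃ C, ∀ n, 1 ≤ n → ∫ ω, f (K n ω) *
      (risingFactorial (1 + θ) (n - 1) / risingFactorial (1 + θ + l) (n - 1)) ∂μ = C := by
  have := h.prob
  set w : ℕ → ℝ := fun n => risingFactorial (1 + θ) n / risingFactorial (1 + θ + l) n with hw
  have hwpos : ∀ n, 0 < w n := fun n => div_pos (rf_pos (by linarith) n) (rf_pos hl n)
  set Y : ℕ → Ω → ℝ := fun n ω => f (K (n + 1) ω) * w n with hY
  have hYi : ∀ n, Integrable (Y n) μ := fun n =>
    (ep_int_fK h f (n + 1) (by omega) 0).mul_const _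
  have hmeas : ∀ (n : ℕ) (g : ℕ → ℝ), StronglyMeasurable[F n] (fun ω => g (K n ω)) := fun n g =>
    ((measurable_of_countable g).comp (h.meas_K n)).stronglyMeasurable
  have hstep : ∀ n, μ[Y (n + 1) | (shiftF F) n] =ᵐ[μ] Y n := by
    intro n
    have hs := (ep_step h hα1 hθ (n + 1) (by omega)
      (fun j ω => f (K (n + 1) ω + (if j = 0 then 1 else 0)) * w (n + 1)) (Y (n + 1))
      (fun j => hmeas (n + 1) (fun k => f (k + (if j = 0 then 1 else 0)) * w (n + 1)))
      (fun j => (ep_int_fK h f (n + 1) (by omega) _).mul_const _)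
      (Eventually.of_forall fun ω j _ hω => by
        simp only [hY]; rw [ev_K (n + 1) j ω hω])).2
    refine hs.trans ?_
    filter_upwards [ep_q_sum h hα1 hθ (n + 1) (by omega), ep_bounds h (n + 1) (by omega)]
      with ω h1 h2
    rw [Finset.sum_range_succ'] at h1 ⊢
    simp only [Nat.add_eq_zero_iff, one_ne_zero, and_false, if_false, if_true, add_zero]
    rw [← Finset.mul_sum, eq_sub_of_add_eq h1]
    simp only [qv, hY]
    have hr := hrec (K (n + 1) ω) h2.1
    have p1 : (0:ℝ) < ((n + 1 : ℕ) : ℝ) + θ := by push_cast; linarith [(Nat.cast_nonneg n : (0:ℝ) ≤ n)]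
    have p2 : (0:ℝ) < 1 + θ + l + n := by linarith [(Nat.cast_nonneg n : (0:ℝ) ≤ n)]
    have hw1 : w (n + 1) * (1 + θ + l + n) = w n * (1 + θ + n) := by
      simp only [hw, rf_succ]
      have := (rf_pos hl n).ne'
      field_simp
    have e1 : f (K (n + 1) ω) * w (n + 1) * (1 - (α * (K (n + 1) ω : ℝ) + θ) / (((n + 1 : ℕ) : ℝ) + θ))
        + f (K (n + 1) ω + 1) * w (n + 1) * ((α * (K (n + 1) ω : ℝ) + θ) / (((n + 1 : ℕ) : ℝ) + θ))
        = w (n + 1) * (f (K (n + 1) ω) + ((f (K (n + 1) ω + 1) - f (K (n + 1) ω)) *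
          (α * (K (n + 1) ω : ℝ) + θ)) / (((n + 1 : ℕ) : ℝ) + θ)) := by ring
    rw [e1, hr]
    have e2 : f (K (n + 1) ω) + l * f (K (n + 1) ω) / (((n + 1 : ℕ) : ℝ) + θ)
        = f (K (n + 1) ω) * (1 + θ + l + n) / (((n + 1 : ℕ) : ℝ) + θ) := by
      field_simp; push_cast; ring
    rw [e2]
    have e3 : w (n + 1) * (f (K (n + 1) ω) * (1 + θ + l + n) / (((n + 1 : ℕ) : ℝ) + θ))
      = f (K (n + 1) ω) * (w (n + 1) * (1 + θ + l + n)) / (((n + 1 : ℕ) : ℝ) + θ) := by ring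
    rw [e3, hw1]
    field_simp
    push_cast; ring
  have hconst : ∀ n, ∫ ω, Y n ω ∂μ = ∫ ω, Y 0 ω ∂μ := by
    intro n
    induction n with
    | zero => rfl
    | succ n ih =>
      rw [← ih, ← integral_condExp ((shiftF F).le n)]
      exact integral_congr_ae (hstep n)
  have habs : ∀ n, ∫ ω, |Y n ω| ∂μ = ∫ ω, Y n ω ∂μ := by
    intro n
    apply integral_congr_ae
    filter_upwards [ep_bounds h (n + 1) (by omega)] with ω hω
    exact abs_of_nonneg (mul_nonneg (hf _ hω.1) (hwpos n).le)
  constructor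
  · have := mart_conv (shiftF F) Y
      (fun n => hmeas (n + 1) (fun k => f k * w n)) hYi hstep
      (∫ ω, Y 0 ω ∂μ) (fun n => by rw [habs, hconst])
    filter_upwards [this] with ω ⟨c, hc⟩
    refine ⟨c, ?_⟩
    rw [← tendsto_add_atTop_iff_nat 1]
    simpa only [Nat.add_sub_cancel] using hc
  · refine ⟨∫ ω, Y 0 ω ∂μ, fun n hn => ?_⟩
    rw [← hconst (n - 1)]
    simp only [hY, hw]
    rw [Nat.sub_add_cancel hn]

lemma ep_K_limit (h : IsEwensPitman α θ μ F K B) (hα0 : 0 < α) (hα1 : α < 1) (hθ : 0 < α + θ) :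
    (∀ᵐ ω ∂μ, ∃ S, 0 < S ∧ Tendsto (fun n : ℕ => (K n ω : ℝ) / (n : ℝ) ^ α) atTop (𝓝 S)) ∧
    ∃ C, 0 ≤ C ∧ ∀ n : ℕ, 1 ≤ n → ∫ ω, (K n ω : ℝ) ∂μ ≤ C * (n : ℝ) ^ α := by
  have := h.prob
  obtain ⟨hZ, C, hC⟩ := ep_K_mart h hα1 hθ (fun k => α * k + θ) α (by linarith)
    (fun k hk => by
      have : (1:ℝ) ≤ k := by exact_mod_cast hk
      nlinarith)
    (fun k _ => by push_cast; ring)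
  have hθ1 : 0 < 1 + θ := by linarith
  -- ratio asymptotics
  have hrat := rf_ratio (1 + θ) (1 + θ + α) hθ1
  have hg : 0 < Real.Gamma (1 + θ + α) / Real.Gamma (1 + θ) :=
    div_pos (Real.Gamma_pos_of_pos (by linarith)) (Real.Gamma_pos_of_pos hθ1)
  set g1 := Real.Gamma (1 + θ + α) / Real.Gamma (1 + θ) with hg1
  have e1 : (1 + θ) - (1 + θ + α) = -α := by ring
  rw [e1] at hrat
  set w : ℕ → ℝ := fun n => risingFactorial (1 + θ) (n - 1) / risingFactorial (1 + θ + α) (n - 1)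
    with hw
  have hwpos : ∀ n, 0 < w n := fun n => div_pos (rf_pos hθ1 _) (rf_pos (by linarith) _)
  have hKn : ∀ᵐ ω ∂μ, ∀ n, 1 ≤ n → 1 ≤ K n ω ∧ K n ω ≤ n := by
    rw [ae_all_iff]; intro n; rw [ae_all_iff]; intro hn
    filter_upwards [ep_bounds h n hn] with ω hω
    exact ⟨hω.1, hω.2.1⟩
  constructor
  · -- second martingale
    set x0 := 1 + θ / α with hx0
    have hx0p : 0 < x0 := by rw [hx0]; field_simp; linarith
    set p := x0 / 2 with hp
    have hpp : 0 < p := by positivity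
    have hαp : α * p = (α + θ) / 2 := by rw [hp, hx0]; field_simp
    obtain ⟨hY, -⟩ := ep_K_mart h hα1 hθ
      (fun k => risingFactorial (x0 - p) (k - 1) / risingFactorial x0 (k - 1)) (-(α * p))
      (by rw [hαp]; linarith)
      (fun k _ => (div_pos (rf_pos (by linarith) _) (rf_pos hx0p _)).le)
      (fun k hk => by
        obtain ⟨m, rfl⟩ : ∃ m, k = m + 1 := ⟨k - 1, by omega⟩
        simp only [Nat.add_sub_cancel, rf_succ]
        have q1 := (rf_pos hx0p m).ne'
        have q2 : x0 + m ≠ 0 := by positivity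
        have q3 : α * ((m + 1 : ℕ) : ℝ) + θ = α * (x0 + m) := by
          rw [hx0]; push_cast; field_simp; ring
        rw [q3]
        field_simp
        ring)
    -- lower bound for g
    have hlowg : ∃ c > 0, ∀ k : ℕ, 1 ≤ k →
        c ≤ risingFactorial (x0 - p) (k - 1) / risingFactorial x0 (k - 1) * (k : ℝ) ^ p := by
      have hr := rf_ratio (x0 - p) x0 (by linarith)
      have hgp : 0 < Real.Gamma x0 / Real.Gamma (x0 - p) :=
        div_pos (Real.Gamma_pos_of_pos hx0p) (Real.Gamma_pos_of_pos (by linarith))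
      have e2 : x0 - p - x0 = -p := by ring
      rw [e2] at hr
      obtain ⟨N, hN⟩ := eventually_atTop.1 (hr.eventually (lt_mem_nhds (half_lt_self hgp)))
      have hpos : ∀ k : ℕ, 1 ≤ k →
        0 < risingFactorial (x0 - p) (k - 1) / risingFactorial x0 (k - 1) * (k : ℝ) ^ p := by
        intro k hk
        have : (0:ℝ) < k := by exact_mod_cast hk
        exact mul_pos (div_pos (rf_pos (by linarith) _) (rf_pos hx0p _)) (by positivity)
      obtain ⟨k0, hk0, hmin⟩ := Finset.exists_min_image (Finset.Icc 1 (N + 1))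
        (fun k : ℕ => risingFactorial (x0 - p) (k - 1) / risingFactorial x0 (k - 1) * (k : ℝ) ^ p)
        ⟨1, by simp⟩
      refine ⟨min _ _, lt_min (half_pos hgp) (hpos k0 (Finset.mem_Icc.1 hk0).1), fun k hk => ?_⟩
      by_cases hkN : N ≤ k
      · refine (min_le_left _ _).trans ?_
        have := (hN k hkN).le
        rwa [Real.rpow_neg (by positivity), div_inv_eq_mul] at this
      · exact (min_le_right _ _).trans (hmin k (Finset.mem_Icc.2 ⟨hk, by omega⟩))
    obtain ⟨c, hc, hclow⟩ := hlowg
    have hr2 := rf_ratio (1 + θ) (1 + θ + -(α * p)) hθ1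
    have hpos2 : 0 < 1 + θ + -(α * p) := by rw [hαp]; linarith
    have hg2 : 0 < Real.Gamma (1 + θ + -(α * p)) / Real.Gamma (1 + θ) :=
      div_pos (Real.Gamma_pos_of_pos hpos2) (Real.Gamma_pos_of_pos hθ1)
    set g2 := Real.Gamma (1 + θ + -(α * p)) / Real.Gamma (1 + θ) with hg2d
    have e3 : 1 + θ - (1 + θ + -(α * p)) = α * p := by ring
    rw [e3] at hr2
    filter_upwards [hZ, hY, hKn] with ω ⟨z, hz⟩ ⟨y, hy⟩ hK
    -- K n / n^α converges
    have hna : Tendsto (fun n : ℕ => θ / (n : ℝ) ^ α) atTop (𝓝 0) :=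
      tendsto_const_nhds.div_atTop ((tendsto_rpow_atTop hα0).comp tendsto_natCast_atTop_atTop)
    have hlim : Tendsto (fun n : ℕ => (K n ω : ℝ) / (n : ℝ) ^ α) atTop (𝓝 (z / g1 / α)) := by
      have h1 := ((hz.div hrat hg.ne').sub hna).div_const α
      rw [sub_zero] at h1
      refine h1.congr' ?_
      filter_upwards [eventually_ge_atTop 1] with n hn
      have hn0 : (0:ℝ) < n := by exact_mod_cast hn
      have q0 := hwpos n
      simp only [hw] at q0
      simp only [Pi.div_apply]
      set W := risingFactorial (1 + θ) (n - 1) / risingFactorial (1 + θ + α) (n - 1)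
      rw [Real.rpow_neg hn0.le]
      have : (0:ℝ) < (n:ℝ) ^ α := by positivity
      field_simp
      ring
    refine ⟨z / g1 / α, ?_, hlim⟩
    -- positivity
    by_contra hneg
    have hge : 0 ≤ z / g1 / α := ge_of_tendsto' hlim (fun n => by positivity)
    have hz0 : z / g1 / α = 0 := le_antisymm (not_lt.1 hneg) hge
    rw [hz0] at hlim
    have hlimp : Tendsto (fun n : ℕ => ((K n ω : ℝ) / (n : ℝ) ^ α) ^ p) atTop (𝓝 0) := by
      have := hlim.rpow_const (p := p) (Or.inr hpp.le)
      rwa [Real.zero_rpow hpp.ne'] at this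
    -- Y_n * (K/n^α)^p → 0 but ≥ c * ratio
    have hprod := hy.mul hlimp
    rw [mul_zero] at hprod
    have hlow := hr2.const_mul c
    have : c * g2 ≤ 0 := by
      refine le_of_tendsto_of_tendsto hlow hprod ?_
      filter_upwards [eventually_ge_atTop 1] with n hn
      have hn0 : (0:ℝ) < n := by exact_mod_cast hn
      have hb := hclow (K n ω) (hK n hn).1
      have hrp : 0 < risingFactorial (1 + θ) (n - 1) / risingFactorial (1 + θ + -(α * p)) (n - 1)
        := div_pos (rf_pos hθ1 _) (rf_pos hpos2 _)
      have hnp : (0:ℝ) < (n:ℝ) ^ (α * p) := by positivity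
      rw [Real.div_rpow (by positivity) (by positivity), ← Real.rpow_mul hn0.le]
      have := mul_le_mul_of_nonneg_right hb (div_pos hrp hnp).le
      refine this.trans (le_of_eq ?_)
      ring
    nlinarith [mul_pos hc hg2]
  · -- expectation bound
    have hev := hrat.eventually (lt_mem_nhds (half_lt_self hg))
    obtain ⟨N, hN⟩ := eventually_atTop.1 hev
    have hint : ∀ n, 1 ≤ n → Integrable (fun ω => (K n ω : ℝ)) μ := fun n hn =>
      ep_int_fK h (fun k => (k : ℝ)) n hn 0
    have hEK : ∀ n, 1 ≤ n → (α * ∫ ω, (K n ω : ℝ) ∂μ + θ) * w n = C := by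
      intro n hn
      rw [← hC n hn, integral_mul_const, integral_add ((hint n hn).const_mul α)
        (integrable_const θ), integral_const_mul]
      simp [hw]
    refine ⟨(|C| / (g1 / 2) + |θ|) / α + (N + 1), by positivity, fun n hn => ?_⟩
    have hn1 : (1:ℝ) ≤ n := by exact_mod_cast hn
    have hna : (1:ℝ) ≤ (n:ℝ) ^ α := Real.one_le_rpow hn1 hα0.le
    have hnn : (0:ℝ) ≤ (|C| / (g1 / 2) + |θ|) / α := by positivity
    by_cases hnN : N ≤ n
    · have h1 := hN n hnN
      have hn0 : (0:ℝ) < n := by linarith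
      rw [Real.rpow_neg hn0.le, div_inv_eq_mul] at h1
      have hW := hwpos n
      have h2 := hEK n hn
      set E := ∫ ω, (K n ω : ℝ) ∂μ
      have h3 : α * E + θ = C / w n := by rw [← h2]; field_simp
      have h4 : C / w n ≤ |C| / (g1 / 2) * (n:ℝ) ^ α := by
        rw [div_le_iff₀ hW]
        have : |C| / (g1 / 2) * (g1 / 2) ≤ |C| / (g1 / 2) * (w n * (n:ℝ) ^ α) :=
          mul_le_mul_of_nonneg_left h1.le (by positivity)
        rw [div_mul_cancel₀ _ (by positivity)] at this
        calc C ≤ |C| := le_abs_self C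
          _ ≤ _ := this
          _ = _ := by ring
      have h5 : -θ ≤ |θ| * (n:ℝ) ^ α := by
        have := neg_le_abs θ
        nlinarith [abs_nonneg θ]
      have h6 : E ≤ (|C| / (g1 / 2) + |θ|) / α * (n:ℝ) ^ α := by
        rw [div_mul_eq_mul_div, le_div_iff₀ hα0]
        linarith
      have : (0:ℝ) ≤ ((N:ℝ) + 1) * (n:ℝ) ^ α := by positivity
      linarith
    · have h1 : ∫ ω, (K n ω : ℝ) ∂μ ≤ ∫ ω, (n : ℝ) ∂μ := by
        apply integral_mono_ae (hint n hn) (integrable_const _)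
        filter_upwards [hKn] with ω hω
        exact_mod_cast (hω n hn).2
      rw [integral_const] at h1
      simp only [probReal_univ, one_smul] at h1
      have h2 : (n : ℝ) ≤ N := by exact_mod_cast (by omega : n ≤ N)
      have h3 : (N:ℝ) + 1 ≤ ((|C| / (g1 / 2) + |θ|) / α + (N + 1)) * (n:ℝ) ^ α := by
        have : (0:ℝ) ≤ (N:ℝ) := Nat.cast_nonneg N
        nlinarith
      linarith
end

section
variable {α θ : ℝ} {Ω : Type*} [mΩ : MeasurableSpace Ω] {μ : Measure Ω} {F : Filtration ℕ mΩ}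
    {K : ℕ → Ω → ℕ} {B : ℕ → ℕ → Ω → ℕ}

lemma noise_conv [IsProbabilityMeasure μ] (η : ℕ → Ω → ℝ) (c : ℕ → ℝ) (R : ℝ)
    (hm : ∀ k, StronglyMeasurable[F (k + 1)] (η k)) (hb : ∀ k, ∀ᵐ ω ∂μ, |η k ω| ≤ c k)
    (h0 : ∀ k, μ[η k | F k] =ᵐ[μ] 0)
    (hR : ∀ n, ∑ k ∈ Finset.range n, ∫ ω, η k ω ^ 2 ∂μ ≤ R) :
    ∀ᵐ ω ∂μ, ∃ T, Tendsto (fun n => ∑ k ∈ Finset.range n, η k ω) atTop (𝓝 T) := by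
  set T : ℕ → Ω → ℝ := fun n ω => ∑ k ∈ Finset.range n, η k ω with hT
  have hTs : ∀ n, T (n + 1) = T n + η n := by
    intro n; ext ω; simp [hT, Finset.sum_range_succ]
  have hTm : ∀ n, StronglyMeasurable[F n] (T n) := by
    intro n
    induction n with
    | zero =>
      have : T 0 = fun _ => 0 := by ext; simp [hT]
      rw [this]; exact stronglyMeasurable_const
    | succ n ih => rw [hTs]; exact (ih.mono (F.mono (by omega))).add (hm n)
  have hTb : ∀ n, ∀ᵐ ω ∂μ, |T n ω| ≤ ∑ k ∈ Finset.range n, c k := by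
    intro n
    filter_upwards [ae_all_iff.2 hb] with ω hω
    exact (Finset.abs_sum_le_sum_abs _ _).trans (Finset.sum_le_sum fun k _ => hω k)
  have aes : ∀ {k : ℕ} {f : Ω → ℝ}, StronglyMeasurable[F k] f → AEStronglyMeasurable f μ :=
    fun {k f} hf => (hf.mono (F.le k)).aestronglyMeasurable
  have hηi : ∀ n, Integrable (η n) μ := fun n => Integrable.of_bound (aes (hm n)) (c n) (hb n)
  have hTi : ∀ n, Integrable (T n) μ := fun n => Integrable.of_bound (aes (hTm n)) _ (hTb n)
  have hη2 : ∀ n, Integrable (fun ω => η n ω ^ 2) μ := by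
    intro n
    refine Integrable.of_bound ((aes (hm n)).pow 2) (c n ^ 2) ?_
    filter_upwards [hb n] with ω hω
    rw [norm_pow, Real.norm_eq_abs]
    exact pow_le_pow_left₀ (abs_nonneg _) hω 2
  have hT2 : ∀ n, Integrable (fun ω => T n ω ^ 2) μ := by
    intro n
    refine Integrable.of_bound ((aes (hTm n)).pow 2) ((∑ k ∈ Finset.range n, c k) ^ 2) ?_
    filter_upwards [hTb n] with ω hω
    rw [norm_pow, Real.norm_eq_abs]
    exact pow_le_pow_left₀ (abs_nonneg _) hω 2
  have hTη : ∀ n, Integrable (T n * η n) μ := by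
    intro n
    refine Integrable.of_bound ((aes (hTm n)).mul (aes (hm n))) ((∑ k ∈ Finset.range n, c k) * c n) ?_
    filter_upwards [hTb n, hb n] with ω h1 h2
    rw [Pi.mul_apply, norm_mul, Real.norm_eq_abs, Real.norm_eq_abs]
    exact mul_le_mul h1 h2 (abs_nonneg _) ((abs_nonneg _).trans h1)
  have hcross : ∀ n, ∫ ω, T n ω * η n ω ∂μ = 0 := by
    intro n
    have h1 : μ[T n * η n | F n] =ᵐ[μ] 0 := by
      filter_upwards [condExp_mul_of_stronglyMeasurable_left (hTm n) (hTη n) (hηi n), h0 n]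
        with ω e1 e2
      rw [e1, Pi.mul_apply, e2]; simp
    change ∫ ω, (T n * η n) ω ∂μ = 0
    rw [← integral_condExp (F.le n), integral_congr_ae h1]; simp
  have hsq : ∀ n, ∫ ω, T n ω ^ 2 ∂μ = ∑ k ∈ Finset.range n, ∫ ω, η k ω ^ 2 ∂μ := by
    intro n
    induction n with
    | zero => simp [hT]
    | succ n ih =>
      rw [Finset.sum_range_succ, ← ih, hTs]
      have e : (fun ω => (T n + η n) ω ^ 2) = fun ω => (T n ω ^ 2 + 2 * (T n ω * η n ω)) + η n ω ^ 2 := by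
        ext ω; simp only [Pi.add_apply]; ring
      have i2 : Integrable (fun ω => 2 * (T n ω * η n ω)) μ := (hTη n).const_mul 2
      have i3 : Integrable (fun ω => T n ω ^ 2 + 2 * (T n ω * η n ω)) μ := (hT2 n).add i2
      rw [e, integral_add i3 (hη2 n), integral_add (hT2 n) i2, integral_const_mul,
        hcross]
      ring
  refine mart_conv F T hTm hTi ?_ (1 + R) ?_
  · intro n
    rw [hTs]
    filter_upwards [condExp_add (hTi n) (hηi n) (F n), h0 n] with ω e1 e2
    rw [e1, Pi.add_apply, e2, condExp_of_stronglyMeasurable (F.le n) (hTm n) (hTi n)]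
    simp
  · intro n
    have h1 : ∫ ω, |T n ω| ∂μ ≤ ∫ ω, (1 + T n ω ^ 2) ∂μ := by
      apply integral_mono (hTi n).abs ((integrable_const 1).add (hT2 n))
      intro ω
      simp only [Pi.add_apply]
      nlinarith [sq_abs (T n ω), sq_nonneg (|T n ω| - 1), abs_nonneg (T n ω)]
    rw [integral_add (integrable_const 1) (hT2 n), hsq] at h1
    simp at h1
    linarith [hR n]

lemma ep_q_bounds (h : IsEwensPitman α θ μ F K B) (hα0 : 0 < α) (hα1 : α < 1) (hθ : 0 < α + θ)
    (n : ℕ) (hn : 1 ≤ n) :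
    ∀ᵐ ω ∂μ, ∀ j, 0 ≤ qv α θ K B n j ω ∧ qv α θ K B n j ω ≤ 1 ∧
      qv α θ K B n j ω ≤ (j + 1 + |θ|) / min 1 (1 + θ) * ((K n ω : ℝ) / n) := by
  filter_upwards [ep_bounds h n hn, ep_q_sum h hα1 hθ n hn] with ω ⟨h1, h2, h3, h4⟩ h5
  have hn1 : (1:ℝ) ≤ n := by exact_mod_cast hn
  have hK1 : (1:ℝ) ≤ K n ω := by exact_mod_cast h1
  have hpos : (0:ℝ) < n + θ := by linarith
  have hκ : 0 < min 1 (1 + θ) := lt_min one_pos (by linarith)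
  have hκn : min 1 (1 + θ) * n ≤ n + θ := by
    rcases le_total 0 θ with ht | ht
    · have := min_le_left 1 (1 + θ); nlinarith
    · have := min_le_right 1 (1 + θ); nlinarith
  have hnn : ∀ j, 0 ≤ qv α θ K B n j ω := by
    intro j
    cases j with
    | zero => exact div_nonneg (by nlinarith) hpos.le
    | succ j =>
      refine div_nonneg (mul_nonneg ?_ (Nat.cast_nonneg _)) hpos.le
      push_cast; linarith [(Nat.cast_nonneg j : (0:ℝ) ≤ j)]
  intro j
  refine ⟨hnn j, ?_, ?_⟩
  · by_cases hj : j ≤ n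
    · rw [← h5]
      exact Finset.single_le_sum (f := fun j => qv α θ K B n j ω) (fun j _ => hnn j)
        (Finset.mem_range.2 (by omega))
    · obtain ⟨m, rfl⟩ : ∃ m, j = m + 1 := ⟨j - 1, by omega⟩
      simp only [qv, h4 (m + 1) (by omega)]; simp
  · have key : qv α θ K B n j ω * (n + θ) ≤ (j + 1 + |θ|) * K n ω := by
      cases j with
      | zero =>
        simp only [qv]
        rw [div_mul_cancel₀ _ hpos.ne']
        have := le_abs_self θ
        have := abs_nonneg θ
        push_cast
        nlinarith
      | succ j =>
        simp only [qv]
        rw [div_mul_cancel₀ _ hpos.ne']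
        have hB : (B (j + 1) n ω : ℝ) ≤ K n ω := by exact_mod_cast h3 (j + 1) (by omega)
        have hB0 : (0:ℝ) ≤ (B (j + 1) n ω : ℝ) := Nat.cast_nonneg _
        have := abs_nonneg θ
        have : (0:ℝ) ≤ j := Nat.cast_nonneg j
        push_cast
        refine mul_le_mul ?_ hB hB0 (by positivity)
        linarith
    have h6 : qv α θ K B n j ω * (min 1 (1 + θ) * n) ≤ (j + 1 + |θ|) * K n ω :=
      (mul_le_mul_of_nonneg_left hκn (hnn j)).trans key
    rw [div_mul_div_comm, le_div_iff₀ (by positivity)]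
    exact h6

lemma ep_q_meas (h : IsEwensPitman α θ μ F K B) (n j : ℕ) :
    StronglyMeasurable[F n] (qv α θ K B n j) := by
  cases j with
  | zero =>
    exact ((measurable_of_countable (fun k : ℕ => (α * (k : ℝ) + θ) / ((n : ℝ) + θ))).comp
      (h.meas_K n)).stronglyMeasurable
  | succ r =>
    exact ((measurable_of_countable (fun k : ℕ => ((((r + 1 : ℕ) : ℝ) - α) * (k : ℝ)) /
      ((n : ℝ) + θ))).comp (h.meas_B (r + 1) n)).stronglyMeasurable

lemma ep_q_int (h : IsEwensPitman α θ μ F K B) (hα0 : 0 < α) (hα1 : α < 1) (hθ : 0 < α + θ)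
    (n : ℕ) (hn : 1 ≤ n) (j : ℕ) : Integrable (qv α θ K B n j) μ := by
  have := h.prob
  refine Integrable.of_bound ((ep_q_meas h n j).mono (F.le n)).aestronglyMeasurable 1 ?_
  filter_upwards [ep_q_bounds h hα0 hα1 hθ n hn] with ω hω
  rw [Real.norm_eq_abs, abs_of_nonneg (hω j).1]
  exact (hω j).2.1

lemma ep_q_integral (h : IsEwensPitman α θ μ F K B) (hα0 : 0 < α) (hα1 : α < 1) (hθ : 0 < α + θ)
    (j : ℕ) : ∃ C, 0 ≤ C ∧ ∀ n : ℕ, 1 ≤ n → ∫ ω, qv α θ K B n j ω ∂μ ≤ C * (n : ℝ) ^ (α - 1) := by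
  obtain ⟨-, C, hC0, hC⟩ := ep_K_limit h hα0 hα1 hθ
  have hκ : 0 < min 1 (1 + θ) := lt_min one_pos (by linarith)
  refine ⟨(j + 1 + |θ|) / min 1 (1 + θ) * C, by positivity, fun n hn => ?_⟩
  have hn0 : (0:ℝ) < n := by exact_mod_cast hn
  have hint : Integrable (fun ω => (K n ω : ℝ)) μ := ep_int_fK h (fun k => (k : ℝ)) n hn 0
  calc ∫ ω, qv α θ K B n j ω ∂μ
      ≤ ∫ ω, (j + 1 + |θ|) / min 1 (1 + θ) * ((K n ω : ℝ) / n) ∂μ := by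
        apply integral_mono_ae (ep_q_int h hα0 hα1 hθ n hn j) ((hint.div_const _).const_mul _)
        filter_upwards [ep_q_bounds h hα0 hα1 hθ n hn] with ω hω
        exact (hω j).2.2
    _ = (j + 1 + |θ|) / min 1 (1 + θ) * ((∫ ω, (K n ω : ℝ) ∂μ) / n) := by
        rw [integral_const_mul, integral_div]
    _ ≤ (j + 1 + |θ|) / min 1 (1 + θ) * (C * (n:ℝ) ^ α / n) := by
        gcongr
        exact hC n hn
    _ = _ := by rw [Real.rpow_sub_one hn0.ne']; ring

lemma sum_pick (n m : ℕ) (hmn : m + 1 ≤ n) (q : ℕ → ℝ) (s : ℝ) :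
    ∑ j ∈ Finset.range (n + 1), (((if m + 1 = j + 1 then 1 else 0) +
      s * (if m + 1 = j then 1 else 0)) * q j) = q m + s * q (m + 1) := by
  have e : ∀ j, ((if m + 1 = j + 1 then (1:ℝ) else 0) + s * (if m + 1 = j then 1 else 0)) * q j
      = (if m = j then q j else 0) + (if m + 1 = j then s * q j else 0) := by
    intro j
    simp only [Nat.add_right_cancel_iff]
    split_ifs <;> ring
  simp only [e, Finset.sum_add_distrib, Finset.sum_ite_eq, Finset.mem_range]
  rw [if_pos (by omega), if_pos (by omega)]

lemma ep_noise (h : IsEwensPitman α θ μ F K B) (hα0 : 0 < α) (hα1 : α < 1) (hθ : 0 < α + θ)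
    (m : ℕ) : ∃ ξ : ℕ → Ω → ℝ,
      (∀ n ω, m + 1 ≤ n → (B (m + 1) (n + 1) ω : ℝ) =
        B (m + 1) n ω + qv α θ K B n m ω - qv α θ K B n (m + 1) ω + ξ n ω) ∧
      ∀ᵐ ω ∂μ, ∃ T, Tendsto
        (fun n => ∑ k ∈ Finset.range n, ξ k ω / ((k : ℝ) + 1) ^ α) atTop (𝓝 T) := by
  have := h.prob
  set Δ : ℕ → Ω → ℝ := fun n ω => (B (m + 1) (n + 1) ω : ℝ) - B (m + 1) n ω with hΔ
  set ξ : ℕ → Ω → ℝ := fun n ω => if m + 1 ≤ n then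
    Δ n ω - (qv α θ K B n m ω - qv α θ K B n (m + 1) ω) else 0 with hξ
  refine ⟨ξ, fun n ω hn => by simp only [hξ, hΔ, if_pos hn]; ring, ?_⟩
  obtain ⟨C1, hC10, hC1⟩ := ep_q_integral h hα0 hα1 hθ m
  obtain ⟨C2, hC20, hC2⟩ := ep_q_integral h hα0 hα1 hθ (m + 1)
  have cm : ∀ (r : ℕ) {k n : ℕ}, k ≤ n → StronglyMeasurable[F n] (fun ω => (B r k ω : ℝ)) :=
    fun r {k n} hk => ((measurable_of_countable (fun k : ℕ => (k : ℝ))).comp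
      (ep_meas_B h r hk)).stronglyMeasurable
  have hΔm : ∀ n, StronglyMeasurable[F (n + 1)] (Δ n) := fun n =>
    (cm (m + 1) le_rfl).sub (cm (m + 1) (by omega))
  have hξm : ∀ n, StronglyMeasurable[F (n + 1)] (ξ n) := by
    intro n
    by_cases hn : m + 1 ≤ n
    · simp only [hξ, if_pos hn]
      exact (hΔm n).sub (((ep_q_meas h n m).mono (F.mono (by omega))).sub
        ((ep_q_meas h n (m + 1)).mono (F.mono (by omega))))
    · simp only [hξ, if_neg hn]; exact stronglyMeasurable_const
  -- conditional expectations
  have hΔc : ∀ n, m + 1 ≤ n → Integrable (Δ n) μ ∧ μ[Δ n | F n] =ᵐ[μ]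
      fun ω => qv α θ K B n m ω - qv α θ K B n (m + 1) ω := by
    intro n hn
    obtain ⟨i1, i2⟩ := ep_step h hα1 hθ n (by omega)
      (fun j _ => (if m + 1 = j + 1 then 1 else 0) + (-1 : ℝ) * (if m + 1 = j then 1 else 0))
      (Δ n) (fun j => stronglyMeasurable_const) (fun j => integrable_const _)
      (Eventually.of_forall fun ω j _ hω => by
        simp only [hΔ]; rw [ev_B n j (m + 1) (by omega) ω hω]; ring)
    refine ⟨i1, i2.trans (Eventually.of_forall fun ω => ?_)⟩
    simp only []
    rw [sum_pick n m hn]; ring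
  have hΔa : ∀ n, m + 1 ≤ n → Integrable (fun ω => |Δ n ω|) μ ∧ μ[fun ω => |Δ n ω| | F n] =ᵐ[μ]
      fun ω => qv α θ K B n m ω + qv α θ K B n (m + 1) ω := by
    intro n hn
    obtain ⟨i1, i2⟩ := ep_step h hα1 hθ n (by omega)
      (fun j _ => (if m + 1 = j + 1 then 1 else 0) + (1 : ℝ) * (if m + 1 = j then 1 else 0))
      (fun ω => |Δ n ω|) (fun j => stronglyMeasurable_const) (fun j => integrable_const _)
      (Eventually.of_forall fun ω j _ hω => by
        simp only [hΔ]; rw [ev_B n j (m + 1) (by omega) ω hω]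
        split_ifs
        · omega
        all_goals simp)
    refine ⟨i1, i2.trans (Eventually.of_forall fun ω => ?_)⟩
    simp only []
    rw [sum_pick n m hn]; ring
  have hqi := fun n hn j => ep_q_int h hα0 hα1 hθ n hn j
  have hξb : ∀ n, ∀ᵐ ω ∂μ, |ξ n ω| ≤ 2 ∧ (m + 1 ≤ n → ξ n ω ^ 2 ≤
      2 * (|Δ n ω| + (qv α θ K B n m ω + qv α θ K B n (m + 1) ω))) := by
    intro n
    by_cases hn : m + 1 ≤ n
    · filter_upwards [ep_q_bounds h hα0 hα1 hθ n (by omega), ep_ev_ae h hα1 hθ n (by omega)]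
        with ω hq ⟨j, hj, hω⟩
      have hd : |Δ n ω| ≤ 1 := by
        simp only [hΔ]; rw [ev_B n j (m + 1) (by omega) ω hω]
        split_ifs <;> simp
      obtain ⟨a1, a2, -⟩ := hq m
      obtain ⟨b1, b2, -⟩ := hq (m + 1)
      have hx : ξ n ω = Δ n ω - (qv α θ K B n m ω - qv α θ K B n (m + 1) ω) := by
        simp only [hξ, if_pos hn]
      have h1 : |ξ n ω| ≤ |Δ n ω| + (qv α θ K B n m ω + qv α θ K B n (m + 1) ω) := by
        rw [hx]
        refine (abs_sub _ _).trans ?_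
        have : |qv α θ K B n m ω - qv α θ K B n (m + 1) ω| ≤
          qv α θ K B n m ω + qv α θ K B n (m + 1) ω := by
          rw [abs_le]; constructor <;> linarith
        linarith
      have h2 : |ξ n ω| ≤ 2 := by
        rw [hx]
        refine (abs_sub _ _).trans ?_
        have : |qv α θ K B n m ω - qv α θ K B n (m + 1) ω| ≤ 1 := by
          rw [abs_le]; constructor <;> linarith
        linarith
      refine ⟨h2, fun _ => ?_⟩
      rw [← sq_abs]
      nlinarith [abs_nonneg (ξ n ω)]
    · refine Eventually.of_forall fun ω => ⟨?_, fun h => absurd h hn⟩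
      simp only [hξ, if_neg hn]; simp
  have hξ0 : ∀ n, μ[ξ n | F n] =ᵐ[μ] 0 := by
    intro n
    by_cases hn : m + 1 ≤ n
    · have e : ξ n = Δ n - (qv α θ K B n m - qv α θ K B n (m + 1)) := by
        ext ω; simp only [hξ, if_pos hn, Pi.sub_apply]
      have hqq : Integrable (qv α θ K B n m - qv α θ K B n (m + 1)) μ :=
        (hqi n (by omega) m).sub (hqi n (by omega) (m + 1))
      rw [e]
      filter_upwards [condExp_sub (hΔc n hn).1 hqq (F n), (hΔc n hn).2] with ω e1 e2
      rw [e1, Pi.sub_apply, e2, condExp_of_stronglyMeasurable (F.le n)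
        ((ep_q_meas h n m).sub (ep_q_meas h n (m + 1))) hqq]
      simp
    · have e : ξ n = 0 := by ext ω; simp only [hξ, if_neg hn]; simp
      rw [e, condExp_zero]
  have hξ2 : ∀ n, Integrable (fun ω => ξ n ω ^ 2) μ := by
    intro n
    refine Integrable.of_bound ((((hξm n).mono (F.le _)).aestronglyMeasurable).pow 2) (2 ^ 2) ?_
    filter_upwards [hξb n] with ω hω
    rw [norm_pow, Real.norm_eq_abs]
    exact pow_le_pow_left₀ (abs_nonneg _) hω.1 2
  have hvar : ∀ n : ℕ, ∫ ω, ξ n ω ^ 2 ∂μ ≤ 4 * (C1 + C2) * (n : ℝ) ^ (α - 1) := by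
    intro n
    by_cases hn : m + 1 ≤ n
    · have hq2 : Integrable (fun ω => qv α θ K B n m ω + qv α θ K B n (m + 1) ω) μ :=
        (hqi n (by omega) m).add (hqi n (by omega) (m + 1))
      have h1 : ∫ ω, ξ n ω ^ 2 ∂μ ≤ ∫ ω, 2 * (|Δ n ω| + (qv α θ K B n m ω +
          qv α θ K B n (m + 1) ω)) ∂μ := by
        apply integral_mono_ae (hξ2 n) (((hΔa n hn).1.add hq2).const_mul 2)
        filter_upwards [hξb n] with ω hω
        exact hω.2 hn
      have h2 : ∫ ω, |Δ n ω| ∂μ = ∫ ω, (qv α θ K B n m ω + qv α θ K B n (m + 1) ω) ∂μ := by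
        rw [← integral_condExp (F.le n)]
        exact integral_congr_ae (hΔa n hn).2
      rw [integral_const_mul, integral_add (hΔa n hn).1 hq2, h2,
        integral_add (hqi n (by omega) m) (hqi n (by omega) (m + 1))] at h1
      have := hC1 n (by omega)
      have := hC2 n (by omega)
      linarith
    · have : ∀ ω, ξ n ω ^ 2 = 0 := by intro ω; simp only [hξ, if_neg hn]; simp
      simp only [this, integral_zero]
      positivity
  have hsum : Summable (fun n : ℕ => 4 * (C1 + C2) * (n : ℝ) ^ (-1 - α)) :=
    (Real.summable_nat_rpow.2 (by linarith)).mul_left _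
  refine noise_conv (F := F) (fun k ω => ξ k ω / ((k : ℝ) + 1) ^ α)
    (fun k => 2 / ((k : ℝ) + 1) ^ α) (∑' n : ℕ, 4 * (C1 + C2) * (n : ℝ) ^ (-1 - α)) ?_ ?_ ?_ ?_
  · intro k
    simp only [div_eq_mul_inv]
    exact (hξm k).mul_const _
  · intro k
    filter_upwards [hξb k] with ω hω
    have : (0:ℝ) < ((k : ℝ) + 1) ^ α := by positivity
    rw [abs_div, abs_of_pos this]
    gcongr
    exact hω.1
  · intro k
    have e : (fun ω => ξ k ω / ((k : ℝ) + 1) ^ α) = (((k : ℝ) + 1) ^ α)⁻¹ • ξ k := by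
      ext ω; simp [div_eq_inv_mul]
    rw [e]
    filter_upwards [condExp_smul (((k : ℝ) + 1) ^ α)⁻¹ (ξ k) (F k) (μ := μ), hξ0 k] with ω e1 e2
    rw [e1, Pi.smul_apply, e2]; simp
  · intro n
    refine le_trans (Finset.sum_le_sum fun k _ => ?_)
      (hsum.sum_le_tsum (Finset.range n) (fun k _ => by positivity))
    by_cases hk : m + 1 ≤ k
    · have hk0 : (0:ℝ) < k := by exact_mod_cast (by omega : 0 < k)
      have e : (fun ω => (ξ k ω / ((k : ℝ) + 1) ^ α) ^ 2) =
        fun ω => ξ k ω ^ 2 / (((k : ℝ) + 1) ^ α) ^ 2 := by ext; rw [div_pow]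
      rw [e, integral_div]
      have p1 : (0:ℝ) < (k : ℝ) ^ α := by positivity
      have p2 : (k : ℝ) ^ α ≤ ((k : ℝ) + 1) ^ α :=
        Real.rpow_le_rpow hk0.le (by linarith) hα0.le
      calc (∫ ω, ξ k ω ^ 2 ∂μ) / (((k : ℝ) + 1) ^ α) ^ 2
          ≤ 4 * (C1 + C2) * (k : ℝ) ^ (α - 1) / ((k : ℝ) ^ α) ^ 2 := by
            gcongr
            exact hvar k
        _ = _ := by
          rw [mul_div_assoc, ← Real.rpow_natCast, ← Real.rpow_mul hk0.le, ← Real.rpow_sub hk0]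
          congr 2
          push_cast; ring
    · have : ∀ ω, ξ k ω = 0 := by intro ω; simp only [hξ, if_neg hk]
      simp only [this]
      simp
      positivity

lemma ep_B_limit (h : IsEwensPitman α θ μ F K B) (hα0 : 0 < α) (hα1 : α < 1) (hθ : 0 < α + θ)
    (m : ℕ) : ∀ᵐ ω ∂μ, ∀ S, Tendsto (fun n : ℕ => (K n ω : ℝ) / (n : ℝ) ^ α) atTop (𝓝 S) →
      Tendsto (fun n : ℕ => (B (m + 1) n ω : ℝ) / (n : ℝ) ^ α) atTop
        (𝓝 (sibuya α (m + 1) * S)) := by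
  induction m with
  | zero =>
    obtain ⟨ξ, h1, h2⟩ := ep_noise h hα0 hα1 hθ 0
    filter_upwards [h2] with ω hω S hS
    have hna : Tendsto (fun n : ℕ => θ / (n : ℝ) ^ α) atTop (𝓝 0) :=
      tendsto_const_nhds.div_atTop ((tendsto_rpow_atTop hα0).comp tendsto_natCast_atTop_atTop)
    have := recursion_limit (fun n => (B 1 n ω : ℝ)) (fun n => α * K n ω + θ) (fun n => ξ n ω)
      (1 - α) θ α (α * S) (by linarith) ?_ hω ?_
    · have e : α * S / (1 - α + α) = sibuya α (0 + 1) * S := by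
        simp [sibuya, risingFactorial]
      rw [e] at this
      exact this
    · filter_upwards [eventually_ge_atTop 1] with n hn
      have := h1 n ω (by omega)
      simp only [qv] at this
      simp only [zero_add] at this
      rw [this]; push_cast; ring
    · have := (hS.const_mul α).add hna
      rw [add_zero] at this
      refine this.congr fun n => ?_
      ring
  | succ m ih =>
    obtain ⟨ξ, h1, h2⟩ := ep_noise h hα0 hα1 hθ (m + 1)
    filter_upwards [h2, ih] with ω hω hprev S hS
    have := recursion_limit (fun n => (B (m + 1 + 1) n ω : ℝ))
      (fun n => (((m + 1 : ℕ) : ℝ) - α) * B (m + 1) n ω) (fun n => ξ n ω)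
      (((m + 1 + 1 : ℕ) : ℝ) - α) θ α ((((m + 1 : ℕ) : ℝ) - α) * (sibuya α (m + 1) * S))
      (by push_cast; linarith [(Nat.cast_nonneg m : (0:ℝ) ≤ m)]) ?_ hω ?_
    · have e : (((m + 1 : ℕ) : ℝ) - α) * (sibuya α (m + 1) * S) / (((m + 1 + 1 : ℕ) : ℝ) - α + α)
          = sibuya α (m + 1 + 1) * S := by
        rw [← mul_assoc, rho_succ, rho, sibuya, Nat.add_sub_cancel, Nat.factorial_succ (m + 1),
          sub_add_cancel, Nat.cast_mul]
        have hf : (0:ℝ) < ((m + 1).factorial : ℝ) := by exact_mod_cast (m + 1).factorial_pos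
        have : (0:ℝ) < ((m + 1 + 1 : ℕ) : ℝ) := by positivity
        field_simp
      rw [e] at this
      exact this
    · filter_upwards [eventually_ge_atTop (m + 1 + 1)] with n hn
      have := h1 n ω hn
      simp only [qv] at this
      rw [this]; ring
    · have := (hprev S hS).const_mul (((m + 1 : ℕ) : ℝ) - α)
      refine this.congr fun n => ?_
      ring

lemma ep_q_limit (h : IsEwensPitman α θ μ F K B) (hα0 : 0 < α) (hα1 : α < 1) (hθ : 0 < α + θ)
    (j : ℕ) : ∀ᵐ ω ∂μ, ∀ S, Tendsto (fun n : ℕ => (K n ω : ℝ) / (n : ℝ) ^ α) atTop (𝓝 S) →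
      Tendsto (fun n : ℕ => qv α θ K B n j ω / (n : ℝ) ^ (α - 1)) atTop (𝓝 (rho α j * S)) := by
  have hnθ : Tendsto (fun n : ℕ => (n : ℝ) / (n + θ)) atTop (𝓝 1) :=
    tendsto_natCast_div_add_atTop θ
  cases j with
  | zero =>
    refine Eventually.of_forall fun ω S hS => ?_
    have hna : Tendsto (fun n : ℕ => θ / (n : ℝ) ^ α) atTop (𝓝 0) :=
      tendsto_const_nhds.div_atTop ((tendsto_rpow_atTop hα0).comp tendsto_natCast_atTop_atTop)
    have := ((hS.const_mul α).add hna).mul hnθ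
    have e : (α * S + 0) * 1 = rho α 0 * S := by simp [rho, risingFactorial]
    rw [e] at this
    refine this.congr' ?_
    filter_upwards [eventually_ge_atTop 1] with n hn
    have hn0 : (0:ℝ) < n := by exact_mod_cast hn
    rw [Real.rpow_sub_one hn0.ne']
    simp only [qv]
    rw [div_div_eq_mul_div]
    ring
  | succ m =>
    filter_upwards [ep_B_limit h hα0 hα1 hθ m] with ω hω S hS
    have := ((hω S hS).const_mul (((m + 1 : ℕ) : ℝ) - α)).mul hnθ
    rw [← mul_assoc, rho_succ, mul_one] at this
    refine this.congr' ?_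
    filter_upwards [eventually_ge_atTop 1] with n hn
    have hn0 : (0:ℝ) < n := by exact_mod_cast hn
    rw [Real.rpow_sub_one hn0.ne']
    simp only [qv]
    rw [div_div_eq_mul_div]
    ring
end

section
variable {α θ : ℝ} {Ω : Type*} [mΩ : MeasurableSpace Ω] {μ : Measure Ω} {F : Filtration ℕ mΩ}
    {K : ℕ → Ω → ℕ} {B : ℕ → ℕ → Ω → ℕ}

lemma ev_S (n j r : ℕ) (hr : 1 ≤ r) (ω : Ω) (hω : ω ∈ Ev K B n j) :
    Sproc α K B r (n + 1) ω = Sproc α K B r n ω + dl α r j := by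
  simp only [Sproc]
  rw [ev_K n j ω hω]
  have e : ∑ i ∈ Finset.Icc 1 r, bCoef α r i * (B i (n + 1) ω : ℝ) =
      ∑ i ∈ Finset.Icc 1 r, bCoef α r i * (B i n ω : ℝ) +
      ((if j + 1 ∈ Finset.Icc 1 r then bCoef α r (j + 1) else 0) -
        (if j ∈ Finset.Icc 1 r then bCoef α r j else 0)) := by
    rw [← Finset.sum_ite_eq' (Finset.Icc 1 r) (j + 1) (fun i => bCoef α r i),
      ← Finset.sum_ite_eq' (Finset.Icc 1 r) j (fun i => bCoef α r i),
      ← Finset.sum_sub_distrib, ← Finset.sum_add_distrib]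
    refine Finset.sum_congr rfl fun i hi => ?_
    rw [ev_B n j i (Finset.mem_Icc.1 hi).1 ω hω]
    split_ifs <;> ring
  rw [e]
  simp only [Finset.mem_Icc]
  rcases Nat.eq_zero_or_pos j with h0 | h0
  · subst h0
    rw [← dl_zero α r hr]
    simp [hr]
    ring
  · rcases lt_trichotomy j r with h1 | h1 | h1
    · rw [← dl_step α r j h1, if_pos (by omega), if_pos (by omega), if_neg (by omega)]
      push_cast; ring
    · subst h1
      rw [← dl_top, if_neg (by omega), if_pos (by omega), if_neg (by omega)]
      push_cast; ring
    · rw [if_neg (by omega), if_neg (by omega), if_neg (by omega), dl, if_neg (by omega)]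
      push_cast; ring

lemma meas_S (h : IsEwensPitman α θ μ F K B) (r n : ℕ) :
    StronglyMeasurable[F n] (Sproc α K B r n) := by
  apply Measurable.stronglyMeasurable
  unfold Sproc
  have hK : Measurable[F n] (fun ω => (K n ω : ℝ)) :=
    (measurable_of_countable (fun k : ℕ => (k : ℝ))).comp (h.meas_K n)
  have hB : ∀ i, Measurable[F n] (fun ω => (B i n ω : ℝ)) := fun i =>
    (measurable_of_countable (fun k : ℕ => (k : ℝ))).comp (h.meas_B i n)
  exact (Finset.measurable_fun_sum _ fun i _ => (hB i).const_mul _).add (hK.const_mul _)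

lemma bound_S (h : IsEwensPitman α θ μ F K B) (r n : ℕ) (hn : 1 ≤ n) :
    ∃ C, ∀ᵐ ω ∂μ, |Sproc α K B r n ω| ≤ C := by
  refine ⟨∑ i ∈ Finset.Icc 1 r, |bCoef α r i| * n + |(-1 : ℝ) ^ r * sibuya α r| * n, ?_⟩
  filter_upwards [ep_bounds h n hn] with ω ⟨h1, h2, h3, h4⟩
  have hK : (K n ω : ℝ) ≤ n := by exact_mod_cast h2
  unfold Sproc
  refine (abs_add_le _ _).trans (add_le_add ((Finset.abs_sum_le_sum_abs _ _).trans
    (Finset.sum_le_sum fun i hi => ?_)) ?_)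
  · rw [abs_mul, Nat.abs_cast]
    have : (B i n ω : ℝ) ≤ n := by exact_mod_cast (h3 i (Finset.mem_Icc.1 hi).1).trans h2
    gcongr
  · rw [abs_mul, Nat.abs_cast]
    gcongr

lemma ep_v (h : IsEwensPitman α θ μ F K B) (hα1 : α < 1) (hθ : 0 < α + θ) (r n : ℕ)
    (hr : 1 ≤ r) (hn : 1 ≤ n) :
    μ[fun ω' => (Mmart α θ K B r (n + 1) ω' - Mmart α θ K B r n ω') ^ 2 | F n] =ᵐ[μ]
      fun ω => ∑ j ∈ Finset.range (n + 1), (aCoef α θ r (n + 1) * dl α r j +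
        (aCoef α θ r (n + 1) - aCoef α θ r n) *
          (Sproc α K B r n ω + (-1 : ℝ) ^ r * sibuya α r * θ / α)) ^ 2 * qv α θ K B n j ω := by
  have := h.prob
  have hm : ∀ j, StronglyMeasurable[F n] (fun ω => (aCoef α θ r (n + 1) * dl α r j +
        (aCoef α θ r (n + 1) - aCoef α θ r n) *
          (Sproc α K B r n ω + (-1 : ℝ) ^ r * sibuya α r * θ / α)) ^ 2) := by
    intro j
    exact (stronglyMeasurable_const.add (((meas_S h r n).add
      stronglyMeasurable_const).const_mul _)).pow 2
  refine (ep_step h hα1 hθ n hn (fun j ω => (aCoef α θ r (n + 1) * dl α r j +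
        (aCoef α θ r (n + 1) - aCoef α θ r n) *
          (Sproc α K B r n ω + (-1 : ℝ) ^ r * sibuya α r * θ / α)) ^ 2) _ hm ?_ ?_).2
  · intro j
    obtain ⟨C, hC⟩ := bound_S h r n hn
    refine Integrable.of_bound ((hm j).mono (F.le n)).aestronglyMeasurable
      ((|aCoef α θ r (n + 1) * dl α r j| + |aCoef α θ r (n + 1) - aCoef α θ r n| *
        (C + |(-1 : ℝ) ^ r * sibuya α r * θ / α|)) ^ 2) ?_
    filter_upwards [hC] with ω hω
    rw [norm_pow, Real.norm_eq_abs]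
    refine pow_le_pow_left₀ (abs_nonneg _) ((abs_add_le _ _).trans ?_) 2
    rw [abs_mul (aCoef α θ r (n + 1) - aCoef α θ r n)]
    gcongr
    exact (abs_add_le _ _).trans (by gcongr)
  · refine Eventually.of_forall fun ω j _ hω => ?_
    simp only [Mmart]
    rw [ev_S n j r hr ω hω]
    ring

lemma aCoef_lim (hθ : 0 < α + θ) (hα1 : α < 1) (r : ℕ) :
    Tendsto (fun n : ℕ => aCoef α θ r n / (n : ℝ) ^ ((r : ℝ) - α)) atTop
      (𝓝 (Real.Gamma (α + θ - (r : ℝ) + 1) / Real.Gamma (θ + 1))) := by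
  have := rf_ratio (θ + 1) (α + θ - (r : ℝ) + 1) (by linarith)
  rw [show θ + 1 - (α + θ - (r : ℝ) + 1) = r - α by ring] at this
  refine this.congr' ?_
  filter_upwards [eventually_ge_atTop (r + 1)] with n hn
  rw [aCoef, if_neg (by omega)]

lemma aCoef_rec (hθ : 0 < α + θ) (r n : ℕ) (hn : r + 1 ≤ n) :
    aCoef α θ r (n + 1) = aCoef α θ r n * ((θ + n) / (α + θ - r + n)) := by
  obtain ⟨m, rfl⟩ : ∃ m, n = m + 1 := ⟨n - 1, by omega⟩
  rw [aCoef, aCoef, if_neg (by omega), if_neg (by omega)]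
  simp only [Nat.add_sub_cancel, risingFactorial]
  push_cast
  rw [show θ + 1 + (m : ℝ) = θ + (m + 1) by ring,
    show α + θ - (r : ℝ) + 1 + (m : ℝ) = α + θ - r + (m + 1) by ring, mul_div_mul_comm]

lemma aCoef_diff (hθ : 0 < α + θ) (hα1 : α < 1) (r : ℕ) :
    Tendsto (fun n : ℕ => (aCoef α θ r (n + 1) - aCoef α θ r n) / (n : ℝ) ^ ((r : ℝ) - α - 1)) atTop
      (𝓝 (Real.Gamma (α + θ - (r : ℝ) + 1) / Real.Gamma (θ + 1) * (r - α))) := by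
  have h1 : Tendsto (fun n : ℕ => (n : ℝ) / (n + (α + θ - r))) atTop (𝓝 1) :=
    tendsto_natCast_div_add_atTop _
  have := ((aCoef_lim hθ hα1 r).mul_const ((r : ℝ) - α)).mul h1
  rw [mul_one] at this
  refine this.congr' ?_
  filter_upwards [eventually_ge_atTop (r + 1)] with n hn
  have hn0 : (0:ℝ) < n := by exact_mod_cast (by omega : 0 < n)
  have hnr : (r : ℝ) + 1 ≤ n := by exact_mod_cast hn
  have hp : (n : ℝ) + (α + θ - r) ≠ 0 := by linarith
  have hp' : α + θ - r + (n : ℝ) ≠ 0 := by linarith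
  rw [aCoef_rec hθ r n hn, Real.rpow_sub_one hn0.ne']
  have hw : (0:ℝ) < (n : ℝ) ^ ((r : ℝ) - α) := by positivity
  rw [show α + θ - r + (n : ℝ) = n + (α + θ - r) by ring]
  field_simp
  ring

lemma aCoef_next (hθ : 0 < α + θ) (hα1 : α < 1) (r : ℕ) :
    Tendsto (fun n : ℕ => aCoef α θ r (n + 1) / (n : ℝ) ^ ((r : ℝ) - α)) atTop
      (𝓝 (Real.Gamma (α + θ - (r : ℝ) + 1) / Real.Gamma (θ + 1))) := by
  have h1 : Tendsto (fun n : ℕ => (n : ℝ)⁻¹) atTop (𝓝 0) := tendsto_inv_atTop_nhds_zero_nat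
  have := (aCoef_lim hθ hα1 r).add ((aCoef_diff hθ hα1 r).mul h1)
  rw [mul_zero, add_zero] at this
  refine this.congr' ?_
  filter_upwards [eventually_ge_atTop 1] with n hn
  have hn0 : (0:ℝ) < n := by exact_mod_cast hn
  rw [Real.rpow_sub_one hn0.ne']
  have hw : (0:ℝ) < (n : ℝ) ^ ((r : ℝ) - α) := by positivity
  field_simp
  ring

lemma v_limit (hα0 : 0 < α) (hα1 : α < 1) (r : ℕ) (A E Y Q1 Q2 v : ℕ → ℝ) (G G' y q1 q2 : ℝ)
    (hA : Tendsto (fun n : ℕ => A n / (n : ℝ) ^ ((r : ℝ) - α)) atTop (𝓝 G))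
    (hE : Tendsto (fun n : ℕ => E n / (n : ℝ) ^ ((r : ℝ) - α - 1)) atTop (𝓝 G'))
    (hY : Tendsto (fun n : ℕ => Y n / (n : ℝ) ^ α) atTop (𝓝 y))
    (hQ1 : Tendsto (fun n : ℕ => Q1 n / (n : ℝ) ^ (α - 1)) atTop (𝓝 q1))
    (hQ2 : Tendsto (fun n : ℕ => Q2 n / (n : ℝ) ^ (α - 1)) atTop (𝓝 q2))
    (hv : ∀ᶠ n in atTop, v n = A n ^ 2 * Q2 n + 2 * A n * E n * Y n * Q1 n + E n ^ 2 * Y n ^ 2) :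
    Tendsto (fun n : ℕ => v n / (n : ℝ) ^ (2 * (r : ℝ) - α - 1)) atTop (𝓝 (G ^ 2 * q2)) := by
  have h0 : Tendsto (fun n : ℕ => (n : ℝ) ^ (α - 1)) atTop (𝓝 0) := by
    have := (tendsto_rpow_neg_atTop (show 0 < 1 - α by linarith)).comp tendsto_natCast_atTop_atTop
    rw [neg_sub] at this
    exact this
  have := ((hA.pow 2).mul hQ2).add ((((((hA.mul hE).mul hY).mul hQ1).const_mul 2).add
    ((hE.pow 2).mul (hY.pow 2))).mul h0)
  rw [mul_zero, add_zero] at this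
  refine this.congr' ?_
  filter_upwards [hv, eventually_ge_atTop 1] with n hn h1
  have hn0 : (0:ℝ) < n := by exact_mod_cast h1
  rw [hn]
  have e : (n : ℝ) ^ (2 * (r : ℝ) - α - 1) =
      (n : ℝ) ^ ((r : ℝ) - α) * (n : ℝ) ^ ((r : ℝ) - α) * (n : ℝ) ^ α / n := by
    rw [← Real.rpow_add hn0, ← Real.rpow_add hn0, Real.rpow_sub_one hn0.ne']
    congr 2; ring
  rw [e, Real.rpow_sub_one hn0.ne', Real.rpow_sub_one hn0.ne']
  have hw : (0:ℝ) < (n : ℝ) ^ ((r : ℝ) - α) := by positivity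
  have hu : (0:ℝ) < (n : ℝ) ^ α := by positivity
  generalize (n : ℝ) ^ ((r : ℝ) - α) = w at *
  generalize (n : ℝ) ^ α = u at *
  field_simp
  ring

lemma ep_qv_limit (h : IsEwensPitman α θ μ F K B) (hα0 : 0 < α) (hα1 : α < 1) (hθ : 0 < α + θ)
    (r : ℕ) (hr : 1 ≤ r) : ∀ᵐ ω ∂μ, ∀ S,
      Tendsto (fun n : ℕ => (K n ω : ℝ) / (n : ℝ) ^ α) atTop (𝓝 S) →
        Tendsto
          (fun n : ℕ => (∑ k ∈ Finset.Icc 1 (n - 1),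
              (μ[fun ω' => (Mmart α θ K B r (k + 1) ω' - Mmart α θ K B r k ω') ^ 2
                | F k]) ω) / (n : ℝ) ^ ((2 * (r : ℝ) - α : ℝ)))
          atTop
          (𝓝 (sibuya α r * (risingFactorial ((r : ℝ) - α) r / (Nat.factorial r : ℝ)) *
            (Real.Gamma (α + θ - (r : ℝ) + 1) / Real.Gamma (θ + 1)) ^ 2 * S)) := by
  filter_upwards [ae_all_iff.2 fun j => ep_q_limit h hα0 hα1 hθ j,
    ae_all_iff.2 fun m => ep_B_limit h hα0 hα1 hθ m,
    ae_all_iff.2 fun n => ae_all_iff.2 fun hn => ep_v h hα1 hθ r n hr hn,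
    ae_all_iff.2 fun n => ae_all_iff.2 fun hn => ep_q_sum h hα1 hθ n hn] with ω hq hB hv hs S hS
  have hr1 : (1:ℝ) ≤ r := by exact_mod_cast hr
  have hY : Tendsto (fun n : ℕ => (Sproc α K B r n ω + (-1 : ℝ) ^ r * sibuya α r * θ / α) /
      (n : ℝ) ^ α) atTop (𝓝 (∑ i ∈ Finset.Icc 1 r, bCoef α r i * (sibuya α i * S) +
        (-1 : ℝ) ^ r * sibuya α r * S + 0)) := by
    have hna : Tendsto (fun n : ℕ => ((-1 : ℝ) ^ r * sibuya α r * θ / α) / (n : ℝ) ^ α) atTop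
        (𝓝 0) :=
      tendsto_const_nhds.div_atTop ((tendsto_rpow_atTop hα0).comp tendsto_natCast_atTop_atTop)
    have hb : Tendsto (fun n : ℕ => ∑ i ∈ Finset.Icc 1 r,
        bCoef α r i * ((B i n ω : ℝ) / (n : ℝ) ^ α)) atTop
        (𝓝 (∑ i ∈ Finset.Icc 1 r, bCoef α r i * (sibuya α i * S))) := by
      refine tendsto_finsetSum _ fun i hi => ?_
      obtain ⟨m, rfl⟩ : ∃ m, i = m + 1 := ⟨i - 1, by have := (Finset.mem_Icc.1 hi).1; omega⟩
      exact (hB m S hS).const_mul _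
    refine ((hb.add (hS.const_mul ((-1 : ℝ) ^ r * sibuya α r))).add hna).congr fun n => ?_
    rw [Sproc, add_div, add_div, Finset.sum_div]
    simp only [mul_div_assoc]
  have hQ : ∀ f : ℕ → ℝ, Tendsto (fun n : ℕ => (∑ j ∈ Finset.range (r + 1),
      f j * qv α θ K B n j ω) / (n : ℝ) ^ (α - 1)) atTop
      (𝓝 (∑ j ∈ Finset.range (r + 1), f j * (rho α j * S))) := by
    intro f
    have : Tendsto (fun n : ℕ => (∑ j ∈ Finset.range (r + 1),
      f j * (qv α θ K B n j ω / (n : ℝ) ^ (α - 1)))) atTop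
      (𝓝 (∑ j ∈ Finset.range (r + 1), f j * (rho α j * S))) :=
      tendsto_finsetSum _ fun j _ => (hq j S hS).const_mul _
    refine this.congr fun n => ?_
    rw [Finset.sum_div]
    simp only [mul_div_assoc]
  have hdl : ∀ n, r ≤ n → ∀ f : ℕ → ℝ, (∀ j, r < j → f j = 0) →
      ∑ j ∈ Finset.range (n + 1), f j = ∑ j ∈ Finset.range (r + 1), f j := by
    intro n hn f hf
    symm
    refine Finset.sum_subset (Finset.range_mono (by omega)) fun j _ hj => hf j ?_
    simpa [Nat.lt_succ_iff] using hj
  have hdl0 : ∀ j, r < j → dl α r j = 0 := fun j hj => by rw [dl, if_neg (by omega)]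
  have key := v_limit hα0 hα1 r (fun n => aCoef α θ r (n + 1))
    (fun n => aCoef α θ r (n + 1) - aCoef α θ r n)
    (fun n => Sproc α K B r n ω + (-1 : ℝ) ^ r * sibuya α r * θ / α)
    (fun n => ∑ j ∈ Finset.range (r + 1), dl α r j * qv α θ K B n j ω)
    (fun n => ∑ j ∈ Finset.range (r + 1), dl α r j ^ 2 * qv α θ K B n j ω)
    (fun k => (μ[fun ω' => (Mmart α θ K B r (k + 1) ω' - Mmart α θ K B r k ω') ^ 2
                | F k]) ω) _ _ _ _ _ (aCoef_next hθ hα1 r) (aCoef_diff hθ hα1 r) hY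
    (hQ _) (hQ _) ?_
  · have := cesaro_rpow _ (2 * (r : ℝ) - α) _ (by linarith) key
    convert this using 2
    have e : ∑ j ∈ Finset.range (r + 1), dl α r j ^ 2 * (rho α j * S) =
        (∑ j ∈ Finset.range (r + 1), rho α j * dl α r j ^ 2) * S := by
      rw [Finset.sum_mul]
      exact Finset.sum_congr rfl fun j _ => by ring
    rw [e, comb_identity α r hr]
    have : 2 * (r : ℝ) - α ≠ 0 := by linarith
    rw [eq_div_iff this]
    ring
  · filter_upwards [eventually_ge_atTop r] with n hn
    rw [hv n (by omega), ← hdl n hn (fun j => dl α r j * qv α θ K B n j ω)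
      (fun j hj => by rw [hdl0 j hj, zero_mul]), ← hdl n hn (fun j => dl α r j ^ 2 * qv α θ K B n j ω)
      (fun j hj => by rw [hdl0 j hj]; ring)]
    have h1 := hs n (by omega)
    generalize aCoef α θ r (n + 1) = a
    generalize aCoef α θ r n = a0
    generalize Sproc α K B r n ω + (-1 : ℝ) ^ r * sibuya α r * θ / α = Y
    rw [Finset.mul_sum, Finset.mul_sum, ← mul_one ((a - a0) ^ 2 * Y ^ 2), ← h1, Finset.mul_sum,
      ← Finset.sum_add_distrib, ← Finset.sum_add_distrib]
    exact Finset.sum_congr rfl fun j _ => by ring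
end

/-- There is a positive random variable `S_{α,θ}` (the `α`-diversity) with
`K_n/n^α → S_{α,θ}` a.s., and for every `r ≥ 1` the predictable quadratic variation
`⟨M_r⟩_n = ∑_{k=1}^{n-1} E[(M_{r,k+1} - M_{r,k})² | F_k]` satisfies, almost surely,
`⟨M_r⟩_n / n^(2r-α) → p_α(r) ((r-α)^(r)/r!) (Γ(α+θ-r+1)/Γ(θ+1))² S_{α,θ}`. -/
theorem Mmart_qv_limit (α θ : ℝ) (hα0 : 0 < α) (hα1 : α < 1) (hθ : 0 < α + θ)
    {Ω : Type*} [mΩ : MeasurableSpace Ω] (μ : Measure Ω) (F : Filtration ℕ mΩ)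
    (K : ℕ → Ω → ℕ) (B : ℕ → ℕ → Ω → ℕ) (hEP : IsEwensPitman α θ μ F K B) :
    ∃ S : Ω → ℝ,
      (∀ᵐ ω ∂μ, 0 < S ω ∧
        Tendsto (fun n => (K n ω : ℝ) / (n : ℝ) ^ α) atTop (𝓝 (S ω))) ∧
      ∀ r, 1 ≤ r → ∀ᵐ ω ∂μ,
        Tendsto
          (fun n : ℕ => (∑ k ∈ Finset.Icc 1 (n - 1),
              (μ[fun ω' => (Mmart α θ K B r (k + 1) ω' - Mmart α θ K B r k ω') ^ 2
                | F k]) ω) / (n : ℝ) ^ ((2 * (r : ℝ) - α : ℝ)))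
          atTop
          (𝓝 (sibuya α r * (risingFactorial ((r : ℝ) - α) r / (Nat.factorial r : ℝ)) *
            (Real.Gamma (α + θ - (r : ℝ) + 1) / Real.Gamma (θ + 1)) ^ 2 * S ω)) := by
  classical
  have hlim := (ep_K_limit hEP hα0 hα1 hθ).1
  have hS : ∃ S : Ω → ℝ, ∀ᵐ ω ∂μ, 0 < S ω ∧
      Tendsto (fun n : ℕ => (K n ω : ℝ) / (n : ℝ) ^ α) atTop (𝓝 (S ω)) := by
    refine ⟨fun ω => if hω : ∃ S, 0 < S ∧ Tendsto (fun n : ℕ => (K n ω : ℝ) / (n : ℝ) ^ α)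
      atTop (𝓝 S) then hω.choose else 1, ?_⟩
    filter_upwards [hlim] with ω hω
    simp only [dif_pos hω]
    exact hω.choose_spec
  obtain ⟨S, hS⟩ := hS
  refine ⟨S, hS, fun r hr => ?_⟩
  filter_upwards [hS, ep_qv_limit hEP hα0 hα1 hθ r hr] with ω h1 h2
  exact h2 _ h1.2

end
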